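/- arXiv:2212.11239 — 3 statements merged into one kernel-verified Lean document; each statement's English description precedes it below -/
import Mathlib

section
/- A hypergraph G = (V,E) is β-acyclic if and only if G has a nest point sequence of length |V|; equivalently, if and only if recursively removing a nest point, as long as one can be found, reduces G to the empty hypergraph (∅, ∅). -/
open BigOperators

variable {α : Type*} [DecidableEq α]

/-- `(V, E)` forms a hypergraph: every edge is a subset of `V` of cardinality at least two. -/
def IsHypergraph (V : Finset α) (E : Finset (Finset α)) : Prop :=
  (∀ e ∈ E, e ⊆ V) ∧ ∀ e ∈ E, 2 ≤ e.card

/-- The multilinear set `S_G` of the hypergraph `G = (V, E)`, viewed inside the space of all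
functions on node- and edge-coordinates, with all coordinates outside `V ∪ E` set to zero. -/
def mSet (V : Finset α) (E : Finset (Finset α)) : Set ((α ⊕ Finset α) → ℝ) :=
  { z | (∀ v ∈ V, z (Sum.inl v) = 0 ∨ z (Sum.inl v) = 1)
      ∧ (∀ v, v ∉ V → z (Sum.inl v) = 0)
      ∧ (∀ e, e ∉ E → z (Sum.inr e) = 0)
      ∧ ∀ e ∈ E, z (Sum.inr e) = ∏ v ∈ e, z (Sum.inl v) }

/-- `S̄_H` for a hypergraph `H` with edge set `E₁`, inside the ambient space `{0,1}^{V ∪ E}`: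
the binary points of the ambient hypergraph `(V, E)` whose restriction to the coordinates of
`H` lies in `S_H`. -/
def barSet (V : Finset α) (E E₁ : Finset (Finset α)) : Set ((α ⊕ Finset α) → ℝ) :=
  { z | (∀ v ∈ V, z (Sum.inl v) = 0 ∨ z (Sum.inl v) = 1)
      ∧ (∀ e ∈ E, z (Sum.inr e) = 0 ∨ z (Sum.inr e) = 1)
      ∧ (∀ v, v ∉ V → z (Sum.inl v) = 0)
      ∧ (∀ e, e ∉ E → z (Sum.inr e) = 0)
      ∧ ∀ e ∈ E₁, z (Sum.inr e) = ∏ v ∈ e, z (Sum.inl v) }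

/-- The variable `z_p`: the edge variable if `|p| ≥ 2`, the node variable `z_u` if `p = {u}`,
and `0` if `p = ∅`. -/
def zc (z : (α ⊕ Finset α) → ℝ) (p : Finset α) : ℝ :=
  if 2 ≤ p.card then z (Sum.inr p) else ∑ u ∈ p, z (Sum.inl u)

/-- `v` is a nest point of `(V, E)`: the edges containing `v` are totally ordered by
inclusion. -/
def IsNestPoint (V : Finset α) (E : Finset (Finset α)) (v : α) : Prop :=
  v ∈ V ∧ ∀ e ∈ E, v ∈ e → ∀ f ∈ E, v ∈ f → e ⊆ f ∨ f ⊆ e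

/-- Edge set of the hypergraph `G - v` obtained by removing the node `v`. -/
def eraseE (E : Finset (Finset α)) (v : α) : Finset (Finset α) :=
  (E.image fun e => e.erase v).filter fun p => 2 ≤ p.card

/-- Node set after removing a list of nodes. -/
def eraseListV (V : Finset α) (l : List α) : Finset α := l.foldl Finset.erase V

/-- Edge set after removing a list of nodes. -/
def eraseListE (E : Finset (Finset α)) (l : List α) : Finset (Finset α) := l.foldl eraseE E

/-- `l` is a nest point sequence of `(V, E)`. -/
def IsNestPointSeq (V : Finset α) (E : Finset (Finset α)) (l : List α) : Prop :=
  l.Nodup ∧ ∀ i : Fin l.length,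
    IsNestPoint (eraseListV V (l.take i.1)) (eraseListE E (l.take i.1)) (l.get i)

/-- `(V, E)` is expanded w.r.t. the sequence `l`. -/
def IsExpanded (V : Finset α) (E : Finset (Finset α)) (l : List α) : Prop :=
  IsNestPointSeq V E l ∧
    ∀ e ∈ E, ∀ i ≤ l.length, 2 ≤ (e \ (l.take i).toFinset).card →
      e \ (l.take i).toFinset ∈ E

/-- Edge set of the expansion of `(V, E)` w.r.t. `l`. -/
def expansionE (E : Finset (Finset α)) (l : List α) : Finset (Finset α) :=
  E ∪ E.biUnion fun e =>
    ((Finset.range l.length).image fun i => e \ (l.take (i + 1)).toFinset).filter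
      fun p => 2 ≤ p.card

/-- The hypergraph with edge set `E` contains a β-cycle (of length `t + 3 ≥ 3`). -/
def HasBetaCycle (E : Finset (Finset α)) : Prop :=
  ∃ t : ℕ, ∃ v : Fin (t + 3) → α, ∃ e : Fin (t + 3) → Finset α,
    Function.Injective v ∧ Function.Injective e ∧ (∀ i, e i ∈ E) ∧
      ∀ i j : Fin (t + 3), v i ∈ e j ↔ (j = i ∨ j = i - 1)

/-- The hypergraph with edge set `E` is β-acyclic. -/
def IsBetaAcyclic (E : Finset (Finset α)) : Prop := ¬ HasBetaCycle E

/-- The product `a · z` over the coordinates indexed by `V ∪ E`. -/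
def dotp (V : Finset α) (E : Finset (Finset α)) (a z : (α ⊕ Finset α) → ℝ) : ℝ :=
  (∑ u ∈ V, a (Sum.inl u) * z (Sum.inl u)) + ∑ f ∈ E, a (Sum.inr f) * z (Sum.inr f)

/-- The inequality `a · z ≤ b` is valid for the multilinear polytope of `(V, E)`. -/
def IsValidIneq (V : Finset α) (E : Finset (Finset α)) (a : (α ⊕ Finset α) → ℝ)
    (b : ℝ) : Prop :=
  ∀ z ∈ convexHull ℝ (mSet V E), dotp V E a z ≤ b

/-- The inequality `a · z ≤ b` defines a facet of the multilinear polytope of `(V, E)`: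
it is valid and the face it induces has affine dimension `|V| + |E| - 1`. -/
def IsFacetIneq (V : Finset α) (E : Finset (Finset α)) (a : (α ⊕ Finset α) → ℝ)
    (b : ℝ) : Prop :=
  IsValidIneq V E a b ∧
    Module.finrank ℝ
        (affineSpan ℝ {z ∈ convexHull ℝ (mSet V E) | dotp V E a z = b}).direction
      = V.card + E.card - 1

/-- Restriction of a point to the coordinates indexed by `V' ∪ E'` (zero elsewhere). -/
def restrictTo (V' : Finset α) (E' : Finset (Finset α)) (z : (α ⊕ Finset α) → ℝ) :
    (α ⊕ Finset α) → ℝ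
  | Sum.inl u => if u ∈ V' then z (Sum.inl u) else 0
  | Sum.inr f => if f ∈ E' then z (Sum.inr f) else 0

/-- The set `N(p_j) = p_j ∩ (⋃_{i < j} p_i)` induced by a running intersection ordering. -/
def Nfun {m : ℕ} (p : Fin m → Finset α) (j : Fin m) : Finset α :=
  p j ∩ (Finset.univ.filter fun i => i < j).biUnion p

/-- The standard linearization `MP^LP` of `(V, E)` (with coordinates outside `V ∪ E` set to
zero). -/
def stdLin (V : Finset α) (E : Finset (Finset α)) : Set ((α ⊕ Finset α) → ℝ) :=
  { z | (∀ v, v ∉ V → z (Sum.inl v) = 0)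
      ∧ (∀ e, e ∉ E → z (Sum.inr e) = 0)
      ∧ (∀ v ∈ V, z (Sum.inl v) ≤ 1)
      ∧ ∀ e ∈ E, 0 ≤ z (Sum.inr e)
          ∧ (∑ v ∈ e, z (Sum.inl v)) - (e.card : ℝ) + 1 ≤ z (Sum.inr e)
          ∧ ∀ v ∈ e, z (Sum.inr e) ≤ z (Sum.inl v) }

/-- `S` is the half-space of an extended running intersection inequality of `(V, E)`. -/
def IsERIHalfspace (V : Finset α) (E : Finset (Finset α))
    (S : Set ((α ⊕ Finset α) → ℝ)) : Prop :=
  ∃ (t m : ℕ) (e₀ : Finset α) (eK : Fin t → Finset α) (p : Fin m → Finset α)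
      (idx : Fin t → Fin m) (w : Fin t → Finset α),
    e₀ ∈ E ∧ (∀ k, eK k ∈ E) ∧ (∀ k, (e₀ ∩ eK k).Nonempty) ∧
      Function.Injective p ∧ (∀ j, ∃ k, p j = e₀ ∩ eK k) ∧
      (∀ k, p (idx k) = e₀ ∩ eK k) ∧
      (∀ j : Fin m, 0 < (j : ℕ) → ∃ j' : Fin m, j' < j ∧ Nfun p j ⊆ p j') ∧
      (∀ k, w k ⊆ Nfun p (idx k) ∧ (w k = ∅ ∨ (∃ u ∈ V, w k = {u}) ∨ w k ∈ E)) ∧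
      S = { z | - (∑ k : Fin t, zc z (w k))
            + (∑ u ∈ e₀ \ Finset.univ.biUnion eK, z (Sum.inl u))
            + (∑ k : Fin t, z (Sum.inr (eK k))) - z (Sum.inr e₀)
          ≤ ((e₀ \ Finset.univ.biUnion eK).card : ℝ)
            + ((Finset.univ.filter fun k : Fin t => Nfun p (idx k) = ∅).card : ℝ) - 1 }

/-- The extended running intersection relaxation `MP^ERI` of `(V, E)`. -/
def MPERI (V : Finset α) (E : Finset (Finset α)) : Set ((α ⊕ Finset α) → ℝ) :=
  stdLin V E ∩ ⋂₀ { S | IsERIHalfspace V E S }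

/-- The rows of `A` are sorted lexicographically, reading columns from the last to the first. -/
def RowsLex {ρ κ : Type*} [LinearOrder ρ] [LinearOrder κ] (A : ρ → κ → Prop) : Prop :=
  ∀ i i', i < i' → ∀ c, A i c → ¬ A i' c →
    ∃ c', c < c' ∧ ¬ A i c' ∧ A i' c' ∧ ∀ d, c' < d → (A i d ↔ A i' d)

/-- Rows with increasing binary values are lexicographically sorted. -/
theorem rowsLex_of_binary {n m : ℕ} (B : Fin n → Fin m → Prop) [∀ i j, Decidable (B i j)]
    (h : ∀ p q, p < q → ∑ j : Fin m, (if B p j then 2 ^ (j : ℕ) else 0) ≤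
      ∑ j : Fin m, (if B q j then 2 ^ (j : ℕ) else 0)) : RowsLex B := by
  intro p q hpq c hpc hqc
  set S : Fin n → Finset ℕ := fun i => (Finset.univ.filter (B i)).map Fin.valEmbedding with hS
  have memS : ∀ i (j : Fin m), (j : ℕ) ∈ S i ↔ B i j := by
    intro i j
    simp [hS, Fin.val_inj]
  have ltS : ∀ i j, j ∈ S i → j < m := by
    intro i j hj
    simp only [hS, Finset.mem_map] at hj
    obtain ⟨a, -, rfl⟩ := hj
    exact a.2
  have sumS : ∀ i, ∑ j ∈ S i, 2 ^ j = ∑ j : Fin m, (if B i j then 2 ^ (j : ℕ) else 0) := by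
    intro i
    rw [hS, Finset.sum_map, Finset.sum_filter]
    rfl
  have hle := h p q hpq
  rw [← sumS, ← sumS, Finset.geomSum_le_geomSum_iff_toColex_le_toColex le_rfl] at hle
  have hne : S p ≠ S q := fun he => hqc ((memS q c).1 (he ▸ (memS p c).2 hpc))
  have hlt := lt_of_le_of_ne hle (fun he => hne (by simpa using he))
  rw [Finset.Colex.toColex_lt_toColex_iff_exists_forall_lt] at hlt
  obtain ⟨a, haq, hap, ha⟩ := hlt
  obtain ⟨b, hb, hbmax⟩ := (symmDiff (S p) (S q)).exists_max_image id
    ⟨a, by simp [Finset.mem_symmDiff, haq, hap]⟩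
  have hbq : b ∈ S q ∧ b ∉ S p := by
    rcases Finset.mem_symmDiff.1 hb with hb | hb
    · have h1 := ha b hb.1 hb.2
      have h2 : a ≤ b := hbmax a (by simp [Finset.mem_symmDiff, haq, hap])
      omega
    · exact hb
  have hbm := ltS _ _ hbq.1
  have hmem : ∀ d : Fin m, b < d → (B p d ↔ B q d) := by
    intro d hd
    by_contra hcon
    have : (d : ℕ) ∈ symmDiff (S p) (S q) := by
      rw [Finset.mem_symmDiff, memS, memS]; tauto
    have : (d : ℕ) ≤ b := hbmax _ this
    omega
  refine ⟨⟨b, hbm⟩, ?_, ?_, ?_, fun d hd => hmem d hd⟩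
  · rw [← not_le]
    intro hle'
    rcases hle'.lt_or_eq with hlt' | heq
    · exact hqc ((hmem c hlt').1 hpc)
    · subst heq
      exact hqc ((memS q _).1 hbq.1)
  · rw [← memS]; exact hbq.2
  · rw [← memS]; exact hbq.1

/-- If exchanging two entries does not increase a weighted sum, these are sorted as the weights. -/
theorem le_of_sum_swap_le {n : ℕ} (R : Fin n → ℕ) {p q : Fin n} (hpq : p < q)
    (h : ∑ i : Fin n, 2 ^ (i : ℕ) * R (Equiv.swap p q i) ≤ ∑ i : Fin n, 2 ^ (i : ℕ) * R i) :
    R p ≤ R q := by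
  have h' : (0 : ℤ) ≤ ∑ i : Fin n, (2 : ℤ) ^ (i : ℕ) * ((R i : ℤ) - R (Equiv.swap p q i)) := by
    simp only [mul_sub, Finset.sum_sub_distrib, sub_nonneg]
    exact_mod_cast h
  rw [Finset.sum_eq_add p q hpq.ne (fun c _ hc => by
    rw [Equiv.swap_apply_of_ne_of_ne hc.1 hc.2, sub_self, mul_zero]) (by simp) (by simp),
    Equiv.swap_apply_left, Equiv.swap_apply_right] at h'
  have hpow : (2 : ℤ) ^ (p : ℕ) < 2 ^ (q : ℕ) := pow_lt_pow_right₀ (by norm_num) hpq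
  by_contra! hlt
  have hlt' : (R q : ℤ) < R p := by exact_mod_cast hlt
  nlinarith

/-- Every finite matrix has a doubly lexical ordering. -/
theorem exists_doubly_lex {n m : ℕ} (A : Fin n → Fin m → Prop) :
    ∃ (σ : Equiv.Perm (Fin n)) (τ : Equiv.Perm (Fin m)),
      RowsLex (fun i j => A (σ i) (τ j)) ∧ RowsLex (fun j i => A (σ i) (τ j)) := by
  classical
  obtain ⟨⟨σ, τ⟩, hmax⟩ := Finite.exists_max
    (fun s : Equiv.Perm (Fin n) × Equiv.Perm (Fin m) =>
      ∑ i : Fin n, ∑ j : Fin m, 2 ^ (i : ℕ) * (2 ^ (j : ℕ) * if A (s.1 i) (s.2 j) then 1 else 0))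
  refine ⟨σ, τ, rowsLex_of_binary _ fun p q hpq => ?_, rowsLex_of_binary _ fun p q hpq => ?_⟩
  · refine le_of_sum_swap_le
      (fun i => ∑ j : Fin m, if A (σ i) (τ j) then 2 ^ (j : ℕ) else 0) hpq ?_
    have h := hmax ((Equiv.swap p q).trans σ, τ)
    simp only [Finset.mul_sum, mul_ite, mul_one, mul_zero] at h ⊢
    exact h
  · refine le_of_sum_swap_le
      (fun j => ∑ i : Fin n, if A (σ i) (τ j) then 2 ^ (i : ℕ) else 0) hpq ?_
    have h := hmax (σ, (Equiv.swap p q).trans τ)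
    simp only [Finset.mul_sum, mul_ite, mul_one, mul_zero] at h ⊢
    have h' := Finset.sum_comm.trans_le (h.trans_eq Finset.sum_comm)
    simpa only [mul_comm, Equiv.trans_apply] using h'

/-- The incidence pattern of an induced path whose middle edge joins row `0` and column `0`. -/
def IsPathPattern {ρ κ : Type*} (A : ρ → κ → Prop) (N : ℕ) (r : ℕ → ρ) (c : ℕ → κ) : Prop :=
  ∀ k < N, ∀ l < N, A (r k) (c l) ↔ (k + 1 = l ∨ l + 1 = k ∨ (k = 0 ∧ l = 0))

/-- Consecutive rows `r k`, `r (k + 1)` agree on all columns after `c (k + 2)`. -/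
def RowsAgree {ρ κ : Type*} [LinearOrder κ] (A : ρ → κ → Prop) (N : ℕ) (r : ℕ → ρ)
    (c : ℕ → κ) : Prop :=
  ∀ k, k + 2 < N → ∀ d, c (k + 2) < d → (A (r k) d ↔ A (r (k + 1)) d)

/-- In a lexicographically sorted matrix, a path pattern can be extended by one column. -/
theorem exists_next_column {ρ κ : Type*} [LinearOrder ρ] [LinearOrder κ] {A : ρ → κ → Prop}
    (hA : RowsLex A) {N : ℕ} {r : ℕ → ρ} {c : ℕ → κ}
    (hr : ∀ k l, k < l → l < N + 2 → r k < r l) (hc : ∀ k l, k < l → l < N + 2 → c k < c l)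
    (hP : IsPathPattern A (N + 2) r c) (hag : RowsAgree A (N + 2) r c) :
    ∃ x, c (N + 1) < x ∧ (∀ k < N + 2, A (r k) x ↔ k = N + 1) ∧
      ∀ d, x < d → (A (r N) d ↔ A (r (N + 1)) d) := by
  obtain ⟨x, hx, h1, h2, h3⟩ := hA (r N) (r (N + 1)) (hr _ _ (by omega) (by omega)) (c (N + 1))
    ((hP N (by omega) (N + 1) (by omega)).2 (by omega))
    (fun h => by have := (hP (N + 1) (by omega) (N + 1) (by omega)).1 h; omega)
  refine ⟨x, hx, ?_, h3⟩
  have hlow : ∀ k, k ≤ N → ¬ A (r (N - k)) x := by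
    intro k
    induction k with
    | zero => intro _; simpa using h1
    | succ k ih =>
      intro hk hcon
      apply ih (by omega)
      have hlt : c (N - (k + 1) + 2) < x := by
        refine lt_of_le_of_lt ?_ hx
        rcases Nat.lt_or_ge (N - (k + 1) + 2) (N + 1) with h | h
        · exact (hc _ _ h (by omega)).le
        · rw [show N - (k + 1) + 2 = N + 1 by omega]
      have := (hag (N - (k + 1)) (by omega) x hlt).1 hcon
      rwa [show N - (k + 1) + 1 = N - k by omega] at this
  intro k hk
  constructor
  · intro h
    by_contra hne
    have := hlow (N - k) (by omega)
    rw [show N - (N - k) = k by omega] at this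
    exact this h
  · rintro rfl
    exact h2

/-- A closed path pattern gives a β-cycle-shaped incidence. -/
theorem exists_cycle_of_closed_pattern {ρ κ : Type*} {A : ρ → κ → Prop} {t : ℕ} {r : ℕ → ρ}
    {c : ℕ → κ} (hr : ∀ k < t + 3, ∀ l < t + 3, r k = r l → k = l)
    (hc : ∀ k < t + 3, ∀ l < t + 3, c k = c l → k = l)
    (h : ∀ k < t + 3, ∀ l < t + 3, A (r k) (c l) ↔
      (k + 1 = l ∨ l + 1 = k ∨ (k = 0 ∧ l = 0) ∨ (k = t + 2 ∧ l = t + 2))) :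
    ∃ (v : Fin (t + 3) → ρ) (e : Fin (t + 3) → κ), Function.Injective v ∧
      Function.Injective e ∧ ∀ i j : Fin (t + 3), A (v i) (e j) ↔ (j = i ∨ j = i - 1) := by
  refine ⟨fun i => r (if 2 * (i : ℕ) ≤ t + 2 then 2 * i else 2 * (t + 3 - i) - 1),
    fun i => c (if 2 * (i : ℕ) + 1 ≤ t + 2 then 2 * i + 1 else 2 * (t + 2 - i)), ?_, ?_, ?_⟩
  · intro i j hij
    have hi := i.2
    have hj := j.2
    have := hr _ (by split_ifs <;> omega) _ (by split_ifs <;> omega) hij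
    apply Fin.ext
    split_ifs at this <;> omega
  · intro i j hij
    have hi := i.2
    have hj := j.2
    have := hc _ (by split_ifs <;> omega) _ (by split_ifs <;> omega) hij
    apply Fin.ext
    split_ifs at this <;> omega
  · intro i j
    have hi := i.2
    have hj := j.2
    have hsub : j = i - 1 ↔ ((i : ℕ) = 0 ∧ (j : ℕ) = t + 2) ∨ (j : ℕ) + 1 = i := by
      rw [eq_sub_iff_add_eq, Fin.ext_iff, Fin.val_add_one]
      split_ifs with hl
      · rw [Fin.ext_iff, Fin.val_last] at hl; omega
      · rw [Fin.ext_iff, Fin.val_last] at hl; omega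
    rw [h _ (by split_ifs <;> omega) _ (by split_ifs <;> omega), hsub, Fin.ext_iff]
    clear hsub
    split_ifs <;> (try simp only [and_false, false_or]) <;> omega

/-- Replacing the tail of an increasing sequence by a larger element keeps it increasing. -/
theorem extend_increasing {β : Type*} [Preorder β] {N : ℕ} {f : ℕ → β} {z : β}
    (hf : ∀ k l, k < l → l < N + 2 → f k < f l) (hz : f (N + 1) < z) (k l : ℕ) (hkl : k < l)
    (hl : l < N + 3) : (if k < N + 2 then f k else z) < (if l < N + 2 then f l else z) := by
  rw [if_pos (show k < N + 2 by omega)]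
  split_ifs with h
  · exact hf k l hkl h
  · rcases Nat.lt_or_ge k (N + 1) with hk | hk
    · exact (hf _ _ hk (by omega)).trans hz
    · rwa [show k = N + 1 by omega]

/-- In a doubly lexically ordered finite matrix, a `Γ` submatrix forces a cycle. -/
theorem exists_cycle_of_gamma {n : ℕ} {κ : Type*} [LinearOrder κ] {A : Fin n → κ → Prop}
    (hA : RowsLex A) (hA' : RowsLex (fun j i => A i j)) {i i' : Fin n} {j j' : κ}
    (hi : i < i') (hj : j < j') (h1 : A i j) (h2 : A i j') (h3 : A i' j) (h4 : ¬ A i' j') :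
    ∃ (t : ℕ) (v : Fin (t + 3) → Fin n) (e : Fin (t + 3) → κ), Function.Injective v ∧
      Function.Injective e ∧ ∀ i j : Fin (t + 3), A (v i) (e j) ↔ (j = i ∨ j = i - 1) := by
  by_contra hno
  have key : ∀ N : ℕ, ∃ (r : ℕ → Fin n) (c : ℕ → κ),
      (∀ k l, k < l → l < N + 2 → r k < r l) ∧ (∀ k l, k < l → l < N + 2 → c k < c l) ∧
      IsPathPattern A (N + 2) r c ∧ RowsAgree A (N + 2) r c ∧
      RowsAgree (fun j i => A i j) (N + 2) c r := by
    intro N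
    induction N with
    | zero =>
      refine ⟨fun k => if k = 0 then i else i', fun k => if k = 0 then j else j',
        ?_, ?_, ?_, fun k hk => by omega, fun k hk => by omega⟩
      · intro k l hkl hl
        obtain rfl : k = 0 := by omega
        obtain rfl : l = 1 := by omega
        simpa using hi
      · intro k l hkl hl
        obtain rfl : k = 0 := by omega
        obtain rfl : l = 1 := by omega
        simpa using hj
      · intro k hk l hl
        interval_cases k <;> interval_cases l <;> simp [h1, h2, h3, h4]
    | succ N ih =>
      obtain ⟨r, c, hr, hc, hP, hag, hag'⟩ := ih
      obtain ⟨x, hx, hxA, hxag⟩ := exists_next_column hA hr hc hP hag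
      obtain ⟨y, hy, hyA, hyag⟩ := exists_next_column hA' hc hr
        (fun k hk l hl => by rw [hP l hl k hk]; omega) hag'
      have hr' := extend_increasing hr hy
      have hc' := extend_increasing hc hx
      have hPat : ∀ k < N + 3, ∀ l < N + 3, ¬ (k = N + 2 ∧ l = N + 2) →
          (A (if k < N + 2 then r k else y) (if l < N + 2 then c l else x) ↔
            (k + 1 = l ∨ l + 1 = k ∨ (k = 0 ∧ l = 0))) := by
        intro k hk l hl hkl
        split_ifs with hk' hl' hl'
        · exact hP k hk' l hl'
        · rw [hxA k hk']; omega
        · rw [hyA l hl']; omega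
        · omega
      have hcorner : ¬ A y x := by
        intro hyx
        apply hno
        refine ⟨N, exists_cycle_of_closed_pattern (r := fun k => if k < N + 2 then r k else y)
          (c := fun k => if k < N + 2 then c k else x) ?_ ?_ ?_⟩
        · intro k hk l hl hkl
          by_contra hne
          rcases Nat.lt_or_gt_of_ne hne with h | h
          · exact (hr' k l h hl).ne hkl
          · exact (hr' l k h hk).ne hkl.symm
        · intro k hk l hl hkl
          by_contra hne
          rcases Nat.lt_or_gt_of_ne hne with h | h
          · exact (hc' k l h hl).ne hkl
          · exact (hc' l k h hk).ne hkl.symm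
        · intro k hk l hl
          by_cases hkl : k = N + 2 ∧ l = N + 2
          · obtain ⟨rfl, rfl⟩ := hkl
            simpa using hyx
          · have := hPat k hk l hl hkl
            rw [this]; tauto
      refine ⟨fun k => if k < N + 2 then r k else y, fun k => if k < N + 2 then c k else x,
        hr', hc', ?_, ?_, ?_⟩
      · intro k hk l hl
        by_cases hkl : k = N + 2 ∧ l = N + 2
        · obtain ⟨rfl, rfl⟩ := hkl
          simpa using hcorner
        · exact hPat k hk l hl hkl
      · intro k hk d hd
        dsimp only at hd ⊢
        rw [if_pos (show k < N + 2 by omega), if_pos (show k + 1 < N + 2 by omega)]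
        split_ifs at hd with h
        · exact hag k h d hd
        · obtain rfl : k = N := by omega
          exact hxag d hd
      · intro k hk d hd
        dsimp only at hd ⊢
        rw [if_pos (show k < N + 2 by omega), if_pos (show k + 1 < N + 2 by omega)]
        split_ifs at hd with h
        · exact hag' k h d hd
        · obtain rfl : k = N := by omega
          exact hyag d hd
  obtain ⟨r, c, hr, -⟩ := key n
  have hinj : Function.Injective (fun k : Fin (n + 2) => r k) := by
    intro k l hkl
    by_contra hne
    rcases lt_or_gt_of_ne hne with h | h
    · exact (hr k l h l.2).ne hkl
    · exact (hr l k h k.2).ne hkl.symm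
  have := Fintype.card_le_of_injective _ hinj
  simp at this

/-- A β-acyclic hypergraph with a node has a nest point. -/
theorem exists_isNestPoint {V : Finset α} {E : Finset (Finset α)} (hG : IsHypergraph V E)
    (hV : V.Nonempty) (hE : IsBetaAcyclic E) : ∃ v, IsNestPoint V E v := by
  obtain ⟨σ, τ, hrow, hcol⟩ := exists_doubly_lex
    (fun (i : Fin V.card) (j : Fin E.card) => (V.equivFin.symm i : α) ∈
      (E.equivFin.symm j : Finset α))
  set ν : Fin V.card → α := fun i => V.equivFin.symm (σ i) with hν
  set ε : Fin E.card → Finset α := fun j => E.equivFin.symm (τ j) with hε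
  have νinj : Function.Injective ν :=
    Subtype.val_injective.comp (V.equivFin.symm.injective.comp σ.injective)
  have εinj : Function.Injective ε :=
    Subtype.val_injective.comp (E.equivFin.symm.injective.comp τ.injective)
  have νsurj : ∀ v ∈ V, ∃ i, ν i = v := fun v hv =>
    ⟨σ.symm (V.equivFin ⟨v, hv⟩), by simp [hν]⟩
  have εsurj : ∀ e ∈ E, ∃ j, ε j = e := fun e he =>
    ⟨τ.symm (E.equivFin ⟨e, he⟩), by simp [hε]⟩
  have hpos : 0 < V.card := hV.card_pos
  have main : ∀ j j' : Fin E.card, j < j' → ν ⟨0, hpos⟩ ∈ ε j → ν ⟨0, hpos⟩ ∈ ε j' →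
      ε j ⊆ ε j' := by
    intro j j' hjj h h' u hu
    by_contra hu'
    obtain ⟨i, rfl⟩ := νsurj u (hG.1 _ (E.equivFin.symm (τ j)).2 hu)
    have hi : (⟨0, hpos⟩ : Fin V.card) < i := by
      rw [Fin.lt_def]
      refine Nat.pos_of_ne_zero fun h0 => hu' ?_
      rwa [show i = ⟨0, hpos⟩ from Fin.ext h0]
    obtain ⟨t, v, e, hv, he, hve⟩ := exists_cycle_of_gamma hrow hcol hi hjj h h' hu hu'
    exact hE ⟨t, ν ∘ v, ε ∘ e, νinj.comp hv, εinj.comp he,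
      fun k => (E.equivFin.symm (τ (e k))).2, hve⟩
  refine ⟨ν ⟨0, hpos⟩, (V.equivFin.symm _).2, fun e he hve f hf hvf => ?_⟩
  obtain ⟨j, rfl⟩ := εsurj e he
  obtain ⟨j', rfl⟩ := εsurj f hf
  rcases lt_trichotomy j j' with h | rfl | h
  · exact Or.inl (main _ _ h hve hvf)
  · exact Or.inl subset_rfl
  · exact Or.inr (main _ _ h hvf hve)

theorem IsHypergraph.erase {V : Finset α} {E : Finset (Finset α)} (hG : IsHypergraph V E)
    (v : α) : IsHypergraph (V.erase v) (eraseE E v) := by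
  refine ⟨fun e he => ?_, fun e he => (Finset.mem_filter.1 he).2⟩
  obtain ⟨f, hf, rfl⟩ := Finset.mem_image.1 (Finset.mem_filter.1 he).1
  exact Finset.erase_subset_erase v (hG.1 f hf)

theorem HasBetaCycle.of_eraseE {E : Finset (Finset α)} {v : α}
    (h : HasBetaCycle (eraseE E v)) : HasBetaCycle E := by
  obtain ⟨t, w, e, hw, he, heE, hinc⟩ := h
  have : ∀ i, ∃ f ∈ E, f.erase v = e i := fun i =>
    Finset.mem_image.1 (Finset.mem_filter.1 (heE i)).1
  choose f hfE hfe using this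
  have hwv : ∀ i, w i ≠ v := by
    intro i
    have hi := (hinc i i).2 (Or.inl rfl)
    rw [← hfe] at hi
    exact Finset.ne_of_mem_erase hi
  refine ⟨t, w, f, hw, fun i j hij => he ?_, hfE, fun i j => ?_⟩
  · rw [← hfe, ← hfe, hij]
  · rw [← hinc, ← hfe, Finset.mem_erase]
    simp [hwv]

open Fin.CommRing in
theorem HasBetaCycle.eraseE {V : Finset α} {E : Finset (Finset α)} {v : α}
    (hv : IsNestPoint V E v) (h : HasBetaCycle E) : HasBetaCycle (eraseE E v) := by
  obtain ⟨t, w, e, hw, he, heE, hinc⟩ := h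
  have h1 : (1 : Fin (t + 3)) ≠ 0 := by simp
  have h2 : (1 : Fin (t + 3)) + 1 ≠ 0 := by
    rw [Ne, Fin.ext_iff, Fin.val_add_one]
    simp [Fin.ext_iff]
  have hnext : ∀ i, w (i + 1) ∈ e i := fun i => (hinc _ _).2 (Or.inr (by simp))
  have hwv : ∀ i, w i ≠ v := by
    rintro i rfl
    rcases hv.2 _ (heE i) ((hinc i i).2 (Or.inl rfl)) _ (heE (i - 1))
      ((hinc i (i - 1)).2 (Or.inr rfl)) with hs | hs
    · rcases (hinc _ _).1 (hs (hnext i)) with h | h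
      · exact h2 (by linear_combination -h)
      · exact h1 (by linear_combination -h)
    · rcases (hinc _ _).1 (hs ((hinc (i - 1) (i - 1)).2 (Or.inl rfl))) with h | h
      · exact h1 (by linear_combination h)
      · exact h2 (by linear_combination h)
  have hinc' : ∀ i j, w i ∈ (e j).erase v ↔ (j = i ∨ j = i - 1) := by
    intro i j
    rw [← hinc, Finset.mem_erase]
    simp [hwv]
  refine ⟨t, w, fun i => (e i).erase v, hw, fun i j hij => ?_, fun i => ?_, hinc'⟩
  · dsimp only at hij
    rcases (hinc' i j).1 (hij ▸ (hinc' i i).2 (Or.inl rfl)) with h | h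
    · exact h.symm
    · rcases (hinc' j i).1 (hij ▸ (hinc' j j).2 (Or.inl rfl)) with h' | h'
      · exact h'
      · exact absurd (by linear_combination h + h') h2
  · refine Finset.mem_filter.2 ⟨Finset.mem_image_of_mem _ (heE i), ?_⟩
    refine Finset.one_lt_card.2 ⟨w i, (hinc' _ _).2 (Or.inl rfl), w (i + 1),
      (hinc' _ _).2 (Or.inr (by simp)), fun h => h1 ?_⟩
    have := hw h
    linear_combination -this

theorem isNestPointSeq_cons {V : Finset α} {E : Finset (Finset α)} {v : α} {l : List α} :
    IsNestPointSeq V E (v :: l) ↔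
      IsNestPoint V E v ∧ v ∉ l ∧ IsNestPointSeq (V.erase v) (eraseE E v) l := by
  unfold IsNestPointSeq
  rw [List.nodup_cons]
  have : (∀ i : Fin (v :: l).length, IsNestPoint (eraseListV V ((v :: l).take i.1))
      (eraseListE E ((v :: l).take i.1)) ((v :: l).get i)) ↔
      IsNestPoint V E v ∧ ∀ i : Fin l.length,
        IsNestPoint (eraseListV (V.erase v) (l.take i.1))
          (eraseListE (eraseE E v) (l.take i.1)) (l.get i) :=
    Fin.forall_fin_succ
  rw [this]
  tauto

theorem IsNestPointSeq.subset {V : Finset α} {E : Finset (Finset α)} {l : List α}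
    (h : IsNestPointSeq V E l) : ∀ v ∈ l, v ∈ V := by
  induction l generalizing V E with
  | nil => simp
  | cons u l ih =>
    rw [isNestPointSeq_cons] at h
    rw [List.forall_mem_cons]
    exact ⟨h.1.1, fun v hv => Finset.mem_of_mem_erase (ih h.2.2 v hv)⟩

/-- a hypergraph is β-acyclic iff it has a nest point sequence of length
`|V|`, i.e. iff recursively removing nest points reduces it to the empty hypergraph. -/
theorem beta_acyclic_iff_nest_point_sequence
    (V : Finset α) (E : Finset (Finset α)) (hG : IsHypergraph V E) :
    IsBetaAcyclic E ↔ ∃ l : List α, IsNestPointSeq V E l ∧ l.length = V.card := by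
  induction hn : V.card generalizing V E with
  | zero =>
    rw [Finset.card_eq_zero] at hn
    subst hn
    refine ⟨fun _ => ⟨[], ⟨List.nodup_nil, fun i => i.elim0⟩, rfl⟩, ?_⟩
    rintro - ⟨t, w, e, -, -, heE, hinc⟩
    exact Finset.notMem_empty _ (hG.1 _ (heE 0) ((hinc 0 0).2 (Or.inl rfl)))
  | succ n ih =>
    have hstep : ∀ v ∈ V, IsBetaAcyclic (eraseE E v) ↔
        ∃ l : List α, IsNestPointSeq (V.erase v) (eraseE E v) l ∧ l.length = n := fun v hv =>
      ih _ _ (hG.erase v) (by rw [Finset.card_erase_of_mem hv, hn]; rfl)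
    constructor
    · intro hE
      obtain ⟨v, hv⟩ := exists_isNestPoint hG (Finset.card_pos.1 (by omega)) hE
      obtain ⟨l, hl, hlen⟩ := (hstep v hv.1).1 fun hc => hE hc.of_eraseE
      exact ⟨v :: l, isNestPointSeq_cons.2
        ⟨hv, fun hvl => Finset.notMem_erase v V (hl.subset v hvl), hl⟩, by simp [hlen]⟩
    · rintro ⟨l, hl, hlen⟩ hc
      obtain _ | ⟨v, l⟩ := l
      · simp at hlen
      · obtain ⟨hv, -, hl⟩ := isNestPointSeq_cons.1 hl
        exact (hstep v hv.1).2 ⟨l, hl, by simpa using hlen⟩ (hc.eraseE hv)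
end

section
/- Let n ≥ 2 and consider the hypergraph G = (V,E) with V = ⋃_{i ∈ [n]} V^i and E = H ∪ ⋃_{i ∈ [n]} E^i, where V^1 = {v^1_3, v^1_4, v^1_7, v^1_8}, V^i = {v^i_1, …, v^i_8} for 2 ≤ i ≤ n−1, V^n = {v^n_1, v^n_2, v^n_5, v^n_6}, H = { {v^i_3, v^i_4, v^{i+1}_1, v^{i+1}_2} : i ∈ [n−1] }, E^1 = { {v^1_3,v^1_4,v^1_7}, {v^1_3,v^1_4,v^1_8}, V^1 }, E^i = { {v^i_1,v^i_2,v^i_5}, {v^i_1,v^i_2,v^i_6}, {v^i_3,v^i_4,v^i_7}, {v^i_3,v^i_4,v^i_8}, V^i } for 2 ≤ i ≤ n−1, and E^n = { {v^n_1,v^n_2,v^n_5}, {v^n_1,v^n_2,v^n_6}, V^n } (all displayed nodes being distinct). Then G is β-acyclic, and the inequality −Σ_{i ∈ [n]} z_{V^i} − Σ_{e ∈ H} z_e + Σ_{i ∈ [n]} Σ_{e ∈ E^i \ {V^i}} z_e ≤ 2n − 3, which has exactly |E| nonzero coefficients, is valid for MP_G and defines a facet of MP_G. -/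
open BigOperators

variable {α : Type*} [DecidableEq α]

/-- The node sets `V^i` of the family of hypergraphs of STATEMENT 11. -/
def Vfam (n i : ℕ) : Finset (ℕ × ℕ) :=
  if i = 1 then {(1, 3), (1, 4), (1, 7), (1, 8)}
  else if i = n then {(n, 1), (n, 2), (n, 5), (n, 6)}
  else {(i, 1), (i, 2), (i, 3), (i, 4), (i, 5), (i, 6), (i, 7), (i, 8)}

/-- The edge sets `E^i` of the family of hypergraphs of STATEMENT 11. -/
def Efam (n i : ℕ) : Finset (Finset (ℕ × ℕ)) :=
  if i = 1 then
    {({(1, 3), (1, 4), (1, 7)} : Finset (ℕ × ℕ)), {(1, 3), (1, 4), (1, 8)}, Vfam n 1}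
  else if i = n then
    {({(n, 1), (n, 2), (n, 5)} : Finset (ℕ × ℕ)), {(n, 1), (n, 2), (n, 6)}, Vfam n n}
  else
    {({(i, 1), (i, 2), (i, 5)} : Finset (ℕ × ℕ)), {(i, 1), (i, 2), (i, 6)},
      {(i, 3), (i, 4), (i, 7)}, {(i, 3), (i, 4), (i, 8)}, Vfam n i}

/-- The connecting edges `H` of the family of hypergraphs of STATEMENT 11. -/
def Hfam (n : ℕ) : Finset (Finset (ℕ × ℕ)) :=
  (Finset.Icc 1 (n - 1)).image fun i =>
    ({(i, 3), (i, 4), (i + 1, 1), (i + 1, 2)} : Finset (ℕ × ℕ))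

/-- The node set `V` of the hypergraph of STATEMENT 11. -/
def bigV (n : ℕ) : Finset (ℕ × ℕ) := (Finset.Icc 1 n).biUnion (Vfam n)

/-- The edge set `E` of the hypergraph of STATEMENT 11. -/
def bigE (n : ℕ) : Finset (Finset (ℕ × ℕ)) := Hfam n ∪ (Finset.Icc 1 n).biUnion (Efam n)

/-- The coefficient vector of the dense inequality of STATEMENT 11: coefficient `-1` on
`z_{V^i}`, `i ∈ [n]`, and on `z_e`, `e ∈ H`; coefficient `1` on `z_e` for all remaining
edges `e ∈ E^i \ {V^i}`; coefficient `0` elsewhere. -/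
def afam (n : ℕ) : (ℕ × ℕ) ⊕ Finset (ℕ × ℕ) → ℝ
  | Sum.inl _ => 0
  | Sum.inr f =>
      if f ∈ (Finset.Icc 1 n).image (Vfam n) then -1
      else if f ∈ Hfam n then -1
      else if f ∈ bigE n then 1
      else 0

section BetaCycle

/-- In a β-cycle, a cycle node whose position is minimal would be a nest point as soon as every
edge is convex with respect to the positions of the nodes which are not nest points. -/
theorem isBetaAcyclic_of_convex {β : Type*} {E : Finset (Finset β)} (P : β → Prop) (pos : β → ℕ)
    (hnest : ∀ v, ¬ P v → ∀ e ∈ E, v ∈ e → ∀ f ∈ E, v ∈ f → e ⊆ f ∨ f ⊆ e)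
    (hconv : ∀ e ∈ E, ∀ f ∈ E, ∀ u ∈ e, ∀ v ∈ e, ∀ w ∈ f, P u → P v → P w →
      pos u ≤ pos w → pos w ≤ pos v → w ∈ e) :
    IsBetaAcyclic E := by
  rintro ⟨t, v, e, -, -, he, hve⟩
  have two_ne : (1 + 1 : Fin (t + 3)) ≠ 0 := by
    rw [Ne, Fin.ext_iff, Fin.val_add, Fin.val_one, Fin.val_zero, Nat.mod_eq_of_lt (by omega)]
    omega
  have one_ne : (1 : Fin (t + 3)) ≠ 0 := by simp
  have mem_self (i) : v i ∈ e i := (hve i i).2 (Or.inl rfl)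
  have mem_pred (i) : v i ∈ e (i - 1) := (hve i (i - 1)).2 (Or.inr rfl)
  have mem_succ (i) : v (i + 1) ∈ e i := (hve _ _).2 (Or.inr (by simp))
  have pred_notMem (i) : v (i - 1) ∉ e i := by
    rw [hve]
    rintro (h | h)
    · exact one_ne (sub_eq_self.1 h.symm)
    · rw [sub_sub, eq_comm, sub_eq_self] at h
      exact two_ne h
  have succ_notMem (i) : v (i + 1) ∉ e (i - 1) := by
    rw [hve]
    rintro (h | h)
    · rw [sub_eq_iff_eq_add, add_assoc, eq_comm, add_eq_left] at h
      exact two_ne h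
    · simp at h
  have hP (i) : P (v i) := by
    by_contra h
    rcases hnest _ h _ (he i) (mem_self i) _ (he (i - 1)) (mem_pred i) with h | h
    · exact succ_notMem i (h (mem_succ i))
    · exact pred_notMem i (h (mem_self (i - 1)))
  obtain ⟨i, hi⟩ := Finite.exists_min fun i => pos (v i)
  rcases le_total (pos (v (i - 1))) (pos (v (i + 1))) with h | h
  · exact pred_notMem i (hconv _ (he i) _ (he (i - 1)) _ (mem_self i) _ (mem_succ i) _
      (mem_self (i - 1)) (hP _) (hP _) (hP _) (hi _) h)
  · exact succ_notMem i (hconv _ (he (i - 1)) _ (he i) _ (mem_pred i) _ (mem_self (i - 1)) _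
      (mem_succ i) (hP _) (hP _) (hP _) (hi _) h)

end BetaCycle

section Dimension

variable {β : Type*} {V : Finset β} {E : Finset (Finset β)}

/-- The linear functional `z ↦ a · z`. -/
def dotpLin (V : Finset β) (E : Finset (Finset β)) (a : (β ⊕ Finset β) → ℝ) :
    ((β ⊕ Finset β) → ℝ) →ₗ[ℝ] ℝ where
  toFun := dotp V E a
  map_add' x y := by
    simp only [dotp, Pi.add_apply, mul_add, Finset.sum_add_distrib]
    ring
  map_smul' c x := by
    simp only [dotp, Pi.smul_apply, smul_eq_mul, RingHom.id_apply, mul_add, Finset.mul_sum]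
    congr 1 <;> exact Finset.sum_congr rfl fun _ _ => by ring

theorem dotp_eq_sum_disjSum (a z : (β ⊕ Finset β) → ℝ) :
    dotp V E a z = ∑ s ∈ V.disjSum E, a s * z s := by
  rw [dotp, Finset.sum_disjSum]

theorem apply_eq_zero_of_mem_convexHull_mSet {z : (β ⊕ Finset β) → ℝ}
    (hz : z ∈ convexHull ℝ (mSet V E)) {s : β ⊕ Finset β} (hs : s ∉ V.disjSum E) : z s = 0 := by
  have hsub : mSet V E ⊆ (LinearMap.ker (LinearMap.proj (R := ℝ) (φ := fun _ => ℝ) s) :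
      Set ((β ⊕ Finset β) → ℝ)) := by
    intro w hw
    rw [SetLike.mem_coe, LinearMap.mem_ker, LinearMap.proj_apply]
    rcases s with u | e
    · exact hw.2.1 u fun h => hs (Finset.inl_mem_disjSum.2 h)
    · exact hw.2.2.1 e fun h => hs (Finset.inr_mem_disjSum.2 h)
  exact convexHull_min hsub (Submodule.convex _) hz

theorem isValidIneq_of_forall_mem_mSet {a : (β ⊕ Finset β) → ℝ} {b : ℝ}
    (h : ∀ z ∈ mSet V E, dotp V E a z ≤ b) : IsValidIneq V E a b :=
  fun _ hz => convexHull_min (t := {z | dotpLin V E a z ≤ b}) h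
    (convex_halfSpace_le (dotpLin V E a).isLinear b) hz

variable [DecidableEq β]

theorem sum_smul_single_disjSum {z : (β ⊕ Finset β) → ℝ} (hz : ∀ s ∉ V.disjSum E, z s = 0) :
    ∑ s ∈ V.disjSum E, z s • (Pi.single s 1 : (β ⊕ Finset β) → ℝ) = z := by
  ext r
  rw [Finset.sum_apply]
  simp only [Pi.smul_apply, Pi.single_apply, smul_eq_mul, mul_ite, mul_one, mul_zero,
    Finset.sum_ite_eq]
  split_ifs with h
  · rfl
  · exact (hz r h).symm

/-- Points supported on the coordinates `V ∪ E` which are annihilated by `a`. -/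
def annihilatedBy (V : Finset β) (E : Finset (Finset β)) (a : (β ⊕ Finset β) → ℝ) :
    Submodule ℝ ((β ⊕ Finset β) → ℝ) where
  carrier := {z | (∀ s ∉ V.disjSum E, z s = 0) ∧ dotp V E a z = 0}
  zero_mem' := ⟨fun _ _ => rfl, (dotpLin V E a).map_zero⟩
  add_mem' := fun {x y} hx hy => ⟨fun s hs => by simp [hx.1 s hs, hy.1 s hs], by
    rw [show dotp V E a (x + y) = _ from (dotpLin V E a).map_add x y]
    change dotp V E a x + dotp V E a y = 0
    rw [hx.2, hy.2, add_zero]⟩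
  smul_mem' := fun c {x} hx => ⟨fun s hs => by simp [hx.1 s hs], by
    rw [show dotp V E a (c • x) = _ from (dotpLin V E a).map_smul c x]
    change c • dotp V E a x = 0
    rw [hx.2, smul_zero]⟩

theorem finrank_annihilatedBy {a : (β ⊕ Finset β) → ℝ} (ha : ∃ s ∈ V.disjSum E, a s ≠ 0) :
    Module.finrank ℝ (annihilatedBy V E a) = V.card + E.card - 1 := by
  let g : (V.disjSum E → ℝ) →ₗ[ℝ] ℝ := ∑ s : V.disjSum E, a s • LinearMap.proj s
  have g_apply (x) : g x = ∑ s : V.disjSum E, a s * x s := by simp [g]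
  have hg : g ≠ 0 := by
    obtain ⟨s, hs, has⟩ := ha
    intro h
    apply has
    have := g_apply (Pi.single ⟨s, hs⟩ 1)
    simpa [h, Pi.single_apply] using this.symm
  have hker := Module.Dual.finrank_ker_add_one_of_ne_zero hg
  rw [Module.finrank_fintype_fun_eq_card, Fintype.card_coe, Finset.card_disjSum] at hker
  have hdotp (z : (β ⊕ Finset β) → ℝ) : g (fun s => z s) = dotp V E a z := by
    rw [g_apply, dotp_eq_sum_disjSum]
    exact Finset.sum_coe_sort (V.disjSum E) fun s => a s * z s
  let ext (x : V.disjSum E → ℝ) : (β ⊕ Finset β) → ℝ :=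
    fun s => if h : s ∈ V.disjSum E then x ⟨s, h⟩ else 0
  have ext_restrict (x) : (fun s : V.disjSum E => ext x s) = x := by
    funext s
    simp [ext, s.2]
  have e : annihilatedBy V E a ≃ₗ[ℝ] LinearMap.ker g :=
    { toFun := fun z => ⟨fun s => z.1 s, by
        rw [LinearMap.mem_ker, hdotp]
        exact z.2.2⟩
      map_add' := fun _ _ => rfl
      map_smul' := fun _ _ => rfl
      invFun := fun x => ⟨ext x.1, fun s hs => dif_neg hs, by
        rw [← hdotp, ext_restrict]
        exact x.2⟩
      left_inv := fun z => by
        ext s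
        by_cases h : s ∈ V.disjSum E
        · simp only [ext, dif_pos h]
        · simp only [ext, dif_neg h, z.2.1 s h]
      right_inv := fun x => Subtype.ext (ext_restrict x.1) }
  rw [e.finrank_eq]
  omega

/-- A valid inequality is facet-defining if it is, up to scaling, determined by its tight
points in the multilinear set. -/
theorem isFacetIneq_of_forall_coeff {a : (β ⊕ Finset β) → ℝ} {b : ℝ}
    (hvalid : IsValidIneq V E a b) (ha : ∃ s ∈ V.disjSum E, a s ≠ 0)
    (huniq : ∀ d : (β ⊕ Finset β) → ℝ,
      (∀ z ∈ mSet V E, dotp V E a z = b → ∀ w ∈ mSet V E, dotp V E a w = b →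
        dotp V E d z = dotp V E d w) → ∃ c : ℝ, ∀ s ∈ V.disjSum E, d s = c * a s) :
    IsFacetIneq V E a b := by
  refine ⟨hvalid, ?_⟩
  rw [← finrank_annihilatedBy ha]
  set F := {z ∈ convexHull ℝ (mSet V E) | dotp V E a z = b} with hF
  suffices (affineSpan ℝ F).direction = annihilatedBy V E a by rw [this]
  rw [direction_affineSpan]
  apply le_antisymm
  · rw [vectorSpan_def, Submodule.span_le]
    rintro _ ⟨x, hx, y, hy, rfl⟩
    refine ⟨fun s hs => ?_, ?_⟩
    · simp [apply_eq_zero_of_mem_convexHull_mSet hx.1 hs,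
        apply_eq_zero_of_mem_convexHull_mSet hy.1 hs]
    · change dotpLin V E a (x - y) = 0
      rw [map_sub]
      change dotp V E a x - dotp V E a y = 0
      rw [hx.2, hy.2, sub_self]
  · intro w hw
    by_contra hwD
    obtain ⟨f, hfw, hf⟩ := Submodule.exists_le_ker_of_notMem hwD
    have f_eq {z : (β ⊕ Finset β) → ℝ} (hz : ∀ s ∉ V.disjSum E, z s = 0) :
        f z = dotp V E (fun s => f (Pi.single s 1)) z := by
      conv_lhs => rw [← sum_smul_single_disjSum hz]
      rw [map_sum, dotp_eq_sum_disjSum]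
      exact Finset.sum_congr rfl fun s _ => by rw [map_smul, smul_eq_mul, mul_comm]
    obtain ⟨c, hc⟩ := huniq (fun s => f (Pi.single s 1)) fun x hx hxb y hy hyb => by
      have hx' := subset_convexHull ℝ _ hx
      have hy' := subset_convexHull ℝ _ hy
      rw [← f_eq fun s hs => apply_eq_zero_of_mem_convexHull_mSet hx' hs,
        ← f_eq fun s hs => apply_eq_zero_of_mem_convexHull_mSet hy' hs, ← sub_eq_zero, ← map_sub]
      exact hf (vsub_mem_vectorSpan ℝ (show x ∈ F from ⟨hx', hxb⟩) (show y ∈ F from ⟨hy', hyb⟩))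
    apply hfw
    rw [f_eq hw.1, dotp_eq_sum_disjSum, Finset.sum_congr rfl fun s hs => by rw [hc s hs, mul_assoc],
      ← Finset.mul_sum, ← dotp_eq_sum_disjSum, hw.2, mul_zero]

/-- The point of the multilinear set whose zero nodes are those in `Z`. -/
def zeroOn (V : Finset β) (E : Finset (Finset β)) (Z : Finset β) : (β ⊕ Finset β) → ℝ
  | Sum.inl u => if u ∈ V ∧ u ∉ Z then 1 else 0
  | Sum.inr e => if e ∈ E ∧ Disjoint e Z then 1 else 0

theorem zeroOn_mem_mSet (hE : ∀ e ∈ E, e ⊆ V) (Z : Finset β) : zeroOn V E Z ∈ mSet V E := by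
  refine ⟨fun v _ => ?_, fun v hv => ?_, fun e he => ?_, fun e he => ?_⟩
  · simp only [zeroOn]
    split_ifs <;> simp
  · simp [zeroOn, hv]
  · simp [zeroOn, he]
  · simp only [zeroOn, he, true_and, Finset.prod_ite_zero, Finset.prod_const_one]
    refine if_congr ?_ rfl rfl
    rw [Finset.disjoint_left]
    exact ⟨fun h u hu => ⟨hE e he hu, h hu⟩, fun h u hu => (h u hu).2⟩

theorem dotp_zeroOn_empty (d : (β ⊕ Finset β) → ℝ) :
    dotp V E d (zeroOn V E ∅) = ∑ u ∈ V, d (Sum.inl u) + ∑ e ∈ E, d (Sum.inr e) := by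
  rw [dotp]
  congr 1 <;> exact Finset.sum_congr rfl fun u hu => by simp [zeroOn, hu]

theorem dotp_zeroOn_singleton (d : (β ⊕ Finset β) → ℝ) {u : β} (hu : u ∈ V) :
    dotp V E d (zeroOn V E {u}) = dotp V E d (zeroOn V E ∅) - d (Sum.inl u)
      - ∑ e ∈ E, if u ∈ e then d (Sum.inr e) else 0 := by
  have hV : ∑ v ∈ V, d (Sum.inl v) * zeroOn V E {u} (Sum.inl v)
      = ∑ v ∈ V, d (Sum.inl v) - d (Sum.inl u) := by
    rw [eq_sub_iff_add_eq, ← Finset.sum_erase_add _ _ hu, ← Finset.sum_erase_add V _ hu]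
    simp only [zeroOn, Finset.mem_singleton, not_true_eq_false, and_false, if_false, mul_zero,
      add_zero]
    congr 1
    refine Finset.sum_congr rfl fun v hv => ?_
    rw [if_pos ⟨Finset.mem_of_mem_erase hv, Finset.ne_of_mem_erase hv⟩, mul_one]
  have hEE : ∑ e ∈ E, d (Sum.inr e) * zeroOn V E {u} (Sum.inr e)
      = ∑ e ∈ E, d (Sum.inr e) - ∑ e ∈ E, if u ∈ e then d (Sum.inr e) else 0 := by
    rw [← Finset.sum_sub_distrib]
    refine Finset.sum_congr rfl fun e he => ?_
    by_cases h : u ∈ e <;> simp [zeroOn, he, h]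
  rw [dotp_zeroOn_empty, dotp, hV, hEE]
  ring

theorem dotp_zeroOn_pair (d : (β ⊕ Finset β) → ℝ) {u v : β} (hv : v ∈ V) (huv : u ≠ v)
    (h : ∀ e ∈ E, v ∈ e → u ∈ e) :
    dotp V E d (zeroOn V E {u, v}) = dotp V E d (zeroOn V E {u}) - d (Sum.inl v) := by
  have hEE : ∑ e ∈ E, d (Sum.inr e) * zeroOn V E {u, v} (Sum.inr e)
      = ∑ e ∈ E, d (Sum.inr e) * zeroOn V E {u} (Sum.inr e) := by
    refine Finset.sum_congr rfl fun e he => ?_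
    by_cases hu : u ∈ e
    · simp [zeroOn, hu]
    · simp [zeroOn, hu, mt (h e he) hu]
  rw [dotp, dotp, hEE, add_sub_right_comm]
  congr 1
  rw [eq_sub_iff_add_eq, ← Finset.sum_erase_add _ _ hv, ← Finset.sum_erase_add V _ hv]
  simp only [zeroOn, Finset.mem_insert, Finset.mem_singleton, or_true, not_true_eq_false, and_false,
    if_false, mul_zero, add_zero, hv, huv.symm, not_false_eq_true, and_self, if_true, mul_one]
  congr 1
  refine Finset.sum_congr rfl fun w hw => ?_
  simp [Finset.ne_of_mem_erase hw]

/-- A facet criterion for inequalities without node coefficients, all of whose star sums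
vanish: it suffices that every node is dominated by another node and that the coefficient
vector is determined up to scaling by the vanishing of its star sums. -/
theorem isFacetIneq_of_star_sums {a : (β ⊕ Finset β) → ℝ} {b : ℝ} (hE : ∀ e ∈ E, e ⊆ V)
    (hvalid : IsValidIneq V E a b) (ha : ∃ e ∈ E, a (Sum.inr e) ≠ 0)
    (hnode : ∀ u, a (Sum.inl u) = 0) (htotal : ∑ e ∈ E, a (Sum.inr e) = b)
    (hstar : ∀ u ∈ V, ∑ e ∈ E, (if u ∈ e then a (Sum.inr e) else 0) = 0)
    (hdom : ∀ v ∈ V, ∃ u ∈ V, u ≠ v ∧ ∀ e ∈ E, v ∈ e → u ∈ e)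
    (huniq : ∀ d : Finset β → ℝ, (∀ u ∈ V, ∑ e ∈ E, (if u ∈ e then d e else 0) = 0) →
      ∃ c : ℝ, ∀ e ∈ E, d e = c * a (Sum.inr e)) :
    IsFacetIneq V E a b := by
  have tight_empty : dotp V E a (zeroOn V E ∅) = b := by
    simp [dotp_zeroOn_empty, hnode, htotal]
  have tight_singleton {u} (hu : u ∈ V) : dotp V E a (zeroOn V E {u}) = b := by
    rw [dotp_zeroOn_singleton a hu, tight_empty, hnode, hstar u hu, sub_zero, sub_zero]
  obtain ⟨e₀, he₀, hae₀⟩ := ha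
  refine isFacetIneq_of_forall_coeff hvalid ⟨_, Finset.inr_mem_disjSum.2 he₀, hae₀⟩
    fun d hd => ?_
  have hd_node : ∀ v ∈ V, d (Sum.inl v) = 0 := by
    intro v hv
    obtain ⟨u, hu, huv, h⟩ := hdom v hv
    have := hd _ (zeroOn_mem_mSet hE {u, v})
      (by rw [dotp_zeroOn_pair a hv huv h, tight_singleton hu, hnode, sub_zero])
      _ (zeroOn_mem_mSet hE {u}) (tight_singleton hu)
    rw [dotp_zeroOn_pair d hv huv h] at this
    linarith
  obtain ⟨c, hc⟩ := huniq (fun e => d (Sum.inr e)) fun u hu => by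
    have := hd _ (zeroOn_mem_mSet hE {u}) (tight_singleton hu) _ (zeroOn_mem_mSet hE ∅) tight_empty
    rw [dotp_zeroOn_singleton d hu, hd_node u hu] at this
    linarith
  refine ⟨c, fun s hs => ?_⟩
  rcases s with u | e
  · rw [hd_node u (Finset.inl_mem_disjSum.1 hs), hnode, mul_zero]
  · exact hc e (Finset.inr_mem_disjSum.1 hs)

end Dimension

section Family

/-- The edge joining block `i` to block `i + 1`. -/
def linkEdge (i : ℕ) : Finset (ℕ × ℕ) := {(i, 3), (i, 4), (i + 1, 1), (i + 1, 2)}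

/-- The edge `{(i, a), (i, b), (i, c)}` of block `i`. -/
def tripleEdge (i a b c : ℕ) : Finset (ℕ × ℕ) := {(i, a), (i, b), (i, c)}

theorem mem_linkEdge {i k c : ℕ} :
    (k, c) ∈ linkEdge i ↔ k = i ∧ (c = 3 ∨ c = 4) ∨ k = i + 1 ∧ (c = 1 ∨ c = 2) := by
  simp only [linkEdge, Finset.mem_insert, Finset.mem_singleton, Prod.mk.injEq]
  tauto

theorem mem_tripleEdge {i a b c k x : ℕ} :
    (k, x) ∈ tripleEdge i a b c ↔ k = i ∧ (x = a ∨ x = b ∨ x = c) := by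
  simp only [tripleEdge, Finset.mem_insert, Finset.mem_singleton, Prod.mk.injEq]
  tauto

theorem mem_Vfam {n i k c : ℕ} (hn : 2 ≤ n) :
    (k, c) ∈ Vfam n i ↔ k = i ∧ ((c = 1 ∨ c = 2 ∨ c = 5 ∨ c = 6) ∧ k ≠ 1 ∨
      (c = 3 ∨ c = 4 ∨ c = 7 ∨ c = 8) ∧ k ≠ n) := by
  unfold Vfam
  split_ifs <;> simp only [Finset.mem_insert, Finset.mem_singleton, Prod.mk.injEq] <;> omega

theorem mem_bigE {m : ℕ} (hm : 1 ≤ m) {e : Finset (ℕ × ℕ)} :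
    e ∈ bigE (m + 1) ↔ (∃ j < m, e = linkEdge (j + 1) ∨ e = tripleEdge (j + 2) 1 2 5 ∨
      e = tripleEdge (j + 2) 1 2 6 ∨ e = tripleEdge (j + 1) 3 4 7 ∨
      e = tripleEdge (j + 1) 3 4 8) ∨ ∃ j < m + 1, e = Vfam (m + 1) (j + 1) := by
  simp only [bigE, Finset.mem_union, Finset.mem_biUnion, Hfam, Finset.mem_image, Finset.mem_Icc]
  constructor
  · rintro (⟨i, hi, rfl⟩ | ⟨i, hi, he⟩)
    · exact Or.inl ⟨i - 1, by omega, Or.inl (by rw [Nat.sub_add_cancel hi.1]; rfl)⟩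
    · obtain ⟨j, rfl⟩ : ∃ j, i = j + 1 := ⟨i - 1, by omega⟩
      unfold Efam at he
      split_ifs at he with h1 h2
      · obtain rfl : j = 0 := by omega
        simp only [Finset.mem_insert, Finset.mem_singleton] at he
        rcases he with rfl | rfl | rfl
        · exact Or.inl ⟨0, by omega, by simp [tripleEdge]⟩
        · exact Or.inl ⟨0, by omega, by simp [tripleEdge]⟩
        · exact Or.inr ⟨0, by omega, rfl⟩
      · simp only [Finset.mem_insert, Finset.mem_singleton] at he
        obtain ⟨p, rfl⟩ : ∃ p, m = p + 1 := ⟨m - 1, by omega⟩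
        rcases he with rfl | rfl | rfl
        · exact Or.inl ⟨p, by omega, by simp [tripleEdge]⟩
        · exact Or.inl ⟨p, by omega, by simp [tripleEdge]⟩
        · exact Or.inr ⟨p + 1, by omega, rfl⟩
      · simp only [Finset.mem_insert, Finset.mem_singleton] at he
        obtain ⟨p, rfl⟩ : ∃ p, j = p + 1 := ⟨j - 1, by omega⟩
        rcases he with rfl | rfl | rfl | rfl | rfl
        · exact Or.inl ⟨p, by omega, by simp [tripleEdge]⟩
        · exact Or.inl ⟨p, by omega, by simp [tripleEdge]⟩
        · exact Or.inl ⟨p + 1, by omega, by simp [tripleEdge]⟩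
        · exact Or.inl ⟨p + 1, by omega, by simp [tripleEdge]⟩
        · exact Or.inr ⟨p + 1, by omega, rfl⟩
  · have left {j : ℕ} (hj : j < m) : tripleEdge (j + 2) 1 2 5 ∈ Efam (m + 1) (j + 2) ∧
        tripleEdge (j + 2) 1 2 6 ∈ Efam (m + 1) (j + 2) := by
      unfold Efam
      split_ifs with h1 h2
      · omega
      · simp [tripleEdge, ← h2]
      · simp [tripleEdge]
    have right {j : ℕ} (hj : j < m) : tripleEdge (j + 1) 3 4 7 ∈ Efam (m + 1) (j + 1) ∧
        tripleEdge (j + 1) 3 4 8 ∈ Efam (m + 1) (j + 1) := by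
      unfold Efam
      split_ifs with h1 h2
      · simp [tripleEdge, h1]
      · omega
      · simp [tripleEdge]
    rintro (⟨j, hj, rfl | rfl | rfl | rfl | rfl⟩ | ⟨j, hj, rfl⟩)
    · exact Or.inl ⟨j + 1, by omega, rfl⟩
    · exact Or.inr ⟨j + 2, by omega, (left hj).1⟩
    · exact Or.inr ⟨j + 2, by omega, (left hj).2⟩
    · exact Or.inr ⟨j + 1, by omega, (right hj).1⟩
    · exact Or.inr ⟨j + 1, by omega, (right hj).2⟩
    · refine Or.inr ⟨j + 1, by omega, ?_⟩
      unfold Efam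
      split_ifs with h1 h2
      · simp [h1]
      · simp [h2]
      · simp

theorem mem_bigV {m : ℕ} (hm : 1 ≤ m) {u : ℕ × ℕ} :
    u ∈ bigV (m + 1) ↔ ∃ j < m, u = (j + 2, 1) ∨ u = (j + 2, 2) ∨ u = (j + 2, 5) ∨
      u = (j + 2, 6) ∨ u = (j + 1, 3) ∨ u = (j + 1, 4) ∨ u = (j + 1, 7) ∨ u = (j + 1, 8) := by
  obtain ⟨k, c⟩ := u
  simp only [bigV, Finset.mem_biUnion, Finset.mem_Icc, mem_Vfam (by omega : 2 ≤ m + 1),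
    Prod.mk.injEq]
  constructor
  · rintro ⟨i, hi, rfl, h | h⟩
    · exact ⟨k - 2, by omega, by omega⟩
    · exact ⟨k - 1, by omega, by omega⟩
  · rintro ⟨j, hj, h⟩
    exact ⟨k, by omega, rfl, by omega⟩

/-- An enumeration of the edges of the family. -/
def edgeOfLabel (m : ℕ) : (ℕ × Fin 5) ⊕ ℕ → Finset (ℕ × ℕ)
  | Sum.inl (j, t) => ![linkEdge (j + 1), tripleEdge (j + 2) 1 2 5, tripleEdge (j + 2) 1 2 6,
      tripleEdge (j + 1) 3 4 7, tripleEdge (j + 1) 3 4 8] t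
  | Sum.inr j => Vfam (m + 1) (j + 1)

/-- The labels of the edges of the family. -/
def edgeLabels (m : ℕ) : Finset ((ℕ × Fin 5) ⊕ ℕ) :=
  (Finset.range m ×ˢ Finset.univ).disjSum (Finset.range (m + 1))

theorem image_edgeOfLabel {m : ℕ} (hm : 1 ≤ m) :
    (edgeLabels m).image (edgeOfLabel m) = bigE (m + 1) := by
  ext e
  rw [mem_bigE hm]
  simp [edgeLabels, edgeOfLabel, Fin.exists_fin_succ, eq_comm, and_or_left, exists_or]

theorem edgeOfLabel_inl_ne_inr {m : ℕ} (hm : 1 ≤ m) {x : ℕ × Fin 5} {j : ℕ} :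
    edgeOfLabel m (Sum.inl x) ≠ edgeOfLabel m (Sum.inr j) := by
  obtain ⟨i, s⟩ := x
  intro h
  have key := fun c => iff_of_eq (congrArg ((j + 1, c) ∈ ·) h)
  have h1 := key 5
  have h2 := key 6
  have h3 := key 7
  have h4 := key 8
  fin_cases s <;>
    simp [edgeOfLabel, mem_linkEdge, mem_tripleEdge, mem_Vfam (by omega : 2 ≤ m + 1)]
      at h1 h2 h3 h4 <;> omega

theorem injOn_edgeOfLabel {m : ℕ} (hm : 1 ≤ m) :
    Set.InjOn (edgeOfLabel m) (edgeLabels m : Set ((ℕ × Fin 5) ⊕ ℕ)) := by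
  rintro (⟨i, s⟩ | i) - (⟨j, t⟩ | j) - h
  · have key := fun k c => iff_of_eq (congrArg ((k, c) ∈ ·) h)
    have h1 := key (i + 1) 3
    have h2 := key (i + 2) 5
    have h3 := key (i + 2) 6
    have h4 := key (i + 1) 7
    have h5 := key (i + 1) 8
    fin_cases s <;> fin_cases t <;>
      simp [edgeOfLabel, mem_linkEdge, mem_tripleEdge] at h1 h2 h3 h4 h5 ⊢ <;> omega
  · exact absurd h (edgeOfLabel_inl_ne_inr hm)
  · exact absurd h.symm (edgeOfLabel_inl_ne_inr hm)
  · have key := fun c => iff_of_eq (congrArg ((i + 1, c) ∈ ·) h)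
    have h1 := key 5
    have h2 := key 7
    simp [edgeOfLabel, mem_Vfam (by omega : 2 ≤ m + 1)] at h1 h2 ⊢
    omega

theorem sum_bigE {m : ℕ} (hm : 1 ≤ m) (g : Finset (ℕ × ℕ) → ℝ) :
    ∑ e ∈ bigE (m + 1), g e = ∑ j ∈ Finset.range m, (g (linkEdge (j + 1)) +
      g (tripleEdge (j + 2) 1 2 5) + g (tripleEdge (j + 2) 1 2 6) + g (tripleEdge (j + 1) 3 4 7) +
      g (tripleEdge (j + 1) 3 4 8)) + ∑ j ∈ Finset.range (m + 1), g (Vfam (m + 1) (j + 1)) := by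
  rw [← image_edgeOfLabel hm, Finset.sum_image (injOn_edgeOfLabel hm), edgeLabels,
    Finset.sum_disjSum, Finset.sum_product]
  simp [edgeOfLabel, Fin.sum_univ_five]

section StarSums

variable {m j : ℕ} (d : Finset (ℕ × ℕ) → ℝ)

theorem star_sum_left_inner (hj : j < m) {c : ℕ} (hc : c = 1 ∨ c = 2) :
    ∑ e ∈ bigE (m + 1), (if (j + 2, c) ∈ e then d e else 0) =
      d (linkEdge (j + 1)) + d (tripleEdge (j + 2) 1 2 5) + d (tripleEdge (j + 2) 1 2 6) +
        d (Vfam (m + 1) (j + 2)) := by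
  rw [sum_bigE (by omega)]
  rcases hc with rfl | rfl <;>
    simp [mem_linkEdge, mem_tripleEdge, mem_Vfam (by omega : 2 ≤ m + 1), Finset.sum_add_distrib, hj]

theorem star_sum_left_outer (hj : j < m) {c : ℕ} (hc : c = 5 ∨ c = 6) :
    ∑ e ∈ bigE (m + 1), (if (j + 2, c) ∈ e then d e else 0) =
      d (tripleEdge (j + 2) 1 2 c) + d (Vfam (m + 1) (j + 2)) := by
  rw [sum_bigE (by omega)]
  rcases hc with rfl | rfl <;>
    simp [mem_linkEdge, mem_tripleEdge, mem_Vfam (by omega : 2 ≤ m + 1), hj]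

theorem star_sum_right_inner (hj : j < m) {c : ℕ} (hc : c = 3 ∨ c = 4) :
    ∑ e ∈ bigE (m + 1), (if (j + 1, c) ∈ e then d e else 0) =
      d (linkEdge (j + 1)) + d (tripleEdge (j + 1) 3 4 7) + d (tripleEdge (j + 1) 3 4 8) +
        d (Vfam (m + 1) (j + 1)) := by
  rw [sum_bigE (by omega)]
  rcases hc with rfl | rfl <;>
    simp [mem_linkEdge, mem_tripleEdge, mem_Vfam (by omega : 2 ≤ m + 1), Finset.sum_add_distrib, hj,
      hj.ne, hj.le]

theorem star_sum_right_outer (hj : j < m) {c : ℕ} (hc : c = 7 ∨ c = 8) :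
    ∑ e ∈ bigE (m + 1), (if (j + 1, c) ∈ e then d e else 0) =
      d (tripleEdge (j + 1) 3 4 c) + d (Vfam (m + 1) (j + 1)) := by
  rw [sum_bigE (by omega)]
  rcases hc with rfl | rfl <;>
    simp [mem_linkEdge, mem_tripleEdge, mem_Vfam (by omega : 2 ≤ m + 1), hj,
      hj.ne, hj.le]

end StarSums

theorem afam_Vfam {n i : ℕ} (hi : i ∈ Finset.Icc 1 n) : afam n (Sum.inr (Vfam n i)) = -1 :=
  if_pos (Finset.mem_image_of_mem _ hi)

theorem afam_linkEdge {m j : ℕ} (hj : j < m) :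
    afam (m + 1) (Sum.inr (linkEdge (j + 1))) = -1 := by
  have : linkEdge (j + 1) ∈ Hfam (m + 1) :=
    Finset.mem_image_of_mem _ (Finset.mem_Icc.2 ⟨by omega, by omega⟩)
  simp [afam, this]

theorem afam_tripleEdge {n i a b c : ℕ} (h : tripleEdge i a b c ∈ bigE n) :
    afam n (Sum.inr (tripleEdge i a b c)) = 1 := by
  have hcard : (tripleEdge i a b c).card ≤ 3 := Finset.card_le_three
  have hV : tripleEdge i a b c ∉ (Finset.Icc 1 n).image (Vfam n) := by
    intro hmem
    obtain ⟨k, -, hk⟩ := Finset.mem_image.1 hmem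
    rw [← hk] at hcard
    unfold Vfam at hcard
    split_ifs at hcard <;> simp at hcard
  have hH : tripleEdge i a b c ∉ Hfam n := by
    intro hmem
    obtain ⟨k, -, hk⟩ := Finset.mem_image.1 hmem
    rw [← hk] at hcard
    simp at hcard
  simp only [afam, if_neg hV, if_neg hH, if_pos h]

theorem afam_values {m j : ℕ} (hj : j < m) :
    afam (m + 1) (Sum.inr (linkEdge (j + 1))) = -1 ∧
    afam (m + 1) (Sum.inr (tripleEdge (j + 2) 1 2 5)) = 1 ∧
    afam (m + 1) (Sum.inr (tripleEdge (j + 2) 1 2 6)) = 1 ∧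
    afam (m + 1) (Sum.inr (tripleEdge (j + 1) 3 4 7)) = 1 ∧
    afam (m + 1) (Sum.inr (tripleEdge (j + 1) 3 4 8)) = 1 ∧
    afam (m + 1) (Sum.inr (Vfam (m + 1) (j + 1))) = -1 ∧
    afam (m + 1) (Sum.inr (Vfam (m + 1) (j + 2))) = -1 := by
  have hm : 1 ≤ m := by omega
  refine ⟨afam_linkEdge hj, afam_tripleEdge ?_, afam_tripleEdge ?_, afam_tripleEdge ?_,
    afam_tripleEdge ?_, afam_Vfam ?_, afam_Vfam ?_⟩
  · exact (mem_bigE hm).2 (Or.inl ⟨j, hj, by simp⟩)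
  · exact (mem_bigE hm).2 (Or.inl ⟨j, hj, by simp⟩)
  · exact (mem_bigE hm).2 (Or.inl ⟨j, hj, by simp⟩)
  · exact (mem_bigE hm).2 (Or.inl ⟨j, hj, by simp⟩)
  · exact Finset.mem_Icc.2 ⟨by omega, by omega⟩
  · exact Finset.mem_Icc.2 ⟨by omega, by omega⟩

theorem sum_afam_mul {m : ℕ} (hm : 1 ≤ m) (g : Finset (ℕ × ℕ) → ℝ) :
    ∑ e ∈ bigE (m + 1), afam (m + 1) (Sum.inr e) * g e =
      ∑ j ∈ Finset.range m, (-g (linkEdge (j + 1)) + g (tripleEdge (j + 2) 1 2 5) +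
        g (tripleEdge (j + 2) 1 2 6) + g (tripleEdge (j + 1) 3 4 7) +
        g (tripleEdge (j + 1) 3 4 8)) - ∑ j ∈ Finset.range (m + 1), g (Vfam (m + 1) (j + 1)) := by
  rw [sum_bigE hm, sub_eq_add_neg, ← Finset.sum_neg_distrib]
  congr 1 <;> refine Finset.sum_congr rfl fun j hj => ?_ <;> rw [Finset.mem_range] at hj
  · obtain ⟨h1, h2, h3, h4, h5, -, -⟩ := afam_values hj
    rw [h1, h2, h3, h4, h5]
    ring
  · rw [afam_Vfam (Finset.mem_Icc.2 ⟨by omega, by omega⟩), neg_one_mul]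

theorem star_sum_afam {m : ℕ} (hm : 1 ≤ m) {u : ℕ × ℕ} (hu : u ∈ bigV (m + 1)) :
    ∑ e ∈ bigE (m + 1), (if u ∈ e then afam (m + 1) (Sum.inr e) else 0) = 0 := by
  obtain ⟨j, hj, h⟩ := (mem_bigV hm).1 hu
  obtain ⟨h1, h2, h3, h4, h5, h6, h7⟩ := afam_values hj
  rcases h with rfl | rfl | rfl | rfl | rfl | rfl | rfl | rfl
  · rw [star_sum_left_inner (fun e => afam (m + 1) (Sum.inr e)) hj (by simp), h1, h2, h3, h7]
    norm_num
  · rw [star_sum_left_inner (fun e => afam (m + 1) (Sum.inr e)) hj (by simp), h1, h2, h3, h7]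
    norm_num
  · rw [star_sum_left_outer (fun e => afam (m + 1) (Sum.inr e)) hj (by simp), h2, h7]
    norm_num
  · rw [star_sum_left_outer (fun e => afam (m + 1) (Sum.inr e)) hj (by simp), h3, h7]
    norm_num
  · rw [star_sum_right_inner (fun e => afam (m + 1) (Sum.inr e)) hj (by simp), h1, h4, h5, h6]
    norm_num
  · rw [star_sum_right_inner (fun e => afam (m + 1) (Sum.inr e)) hj (by simp), h1, h4, h5, h6]
    norm_num
  · rw [star_sum_right_outer (fun e => afam (m + 1) (Sum.inr e)) hj (by simp), h4, h6]
    norm_num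
  · rw [star_sum_right_outer (fun e => afam (m + 1) (Sum.inr e)) hj (by simp), h5, h6]
    norm_num

theorem eq_mul_afam_of_star_sums {m : ℕ} (hm : 1 ≤ m) {d : Finset (ℕ × ℕ) → ℝ}
    (hd : ∀ u ∈ bigV (m + 1), ∑ e ∈ bigE (m + 1), (if u ∈ e then d e else 0) = 0) :
    ∃ c : ℝ, ∀ e ∈ bigE (m + 1), d e = c * afam (m + 1) (Sum.inr e) := by
  have star {j : ℕ} (hj : j < m) (k c : ℕ) (h : k = j + 2 ∧ (c = 1 ∨ c = 5 ∨ c = 6) ∨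
      k = j + 1 ∧ (c = 3 ∨ c = 7 ∨ c = 8)) :=
    hd (k, c) ((mem_bigV hm).2 ⟨j, hj, by simp only [Prod.mk.injEq]; omega⟩)
  have rel {j : ℕ} (hj : j < m) :
      d (tripleEdge (j + 2) 1 2 5) = -d (Vfam (m + 1) (j + 2)) ∧
      d (tripleEdge (j + 2) 1 2 6) = -d (Vfam (m + 1) (j + 2)) ∧
      d (tripleEdge (j + 1) 3 4 7) = -d (Vfam (m + 1) (j + 1)) ∧
      d (tripleEdge (j + 1) 3 4 8) = -d (Vfam (m + 1) (j + 1)) ∧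
      d (linkEdge (j + 1)) = d (Vfam (m + 1) (j + 1)) ∧
      d (linkEdge (j + 1)) = d (Vfam (m + 1) (j + 2)) := by
    have h1 := star hj (j + 2) 1 (by simp)
    have h5 := star hj (j + 2) 5 (by simp)
    have h6 := star hj (j + 2) 6 (by simp)
    have h3 := star hj (j + 1) 3 (by simp)
    have h7 := star hj (j + 1) 7 (by simp)
    have h8 := star hj (j + 1) 8 (by simp)
    rw [star_sum_left_inner d hj (by simp)] at h1
    rw [star_sum_left_outer d hj (by simp)] at h5 h6
    rw [star_sum_right_inner d hj (by simp)] at h3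
    rw [star_sum_right_outer d hj (by simp)] at h7 h8
    refine ⟨?_, ?_, ?_, ?_, ?_, ?_⟩ <;> linarith
  have hV (j : ℕ) (hj : j < m + 1) : d (Vfam (m + 1) (j + 1)) = d (Vfam (m + 1) 1) := by
    induction j with
    | zero => rfl
    | succ j ih =>
      obtain ⟨-, -, -, -, h5, h6⟩ := rel (j := j) (by omega)
      rw [← ih (by omega), ← h5, h6]
  refine ⟨-d (Vfam (m + 1) 1), fun e he => ?_⟩
  rcases (mem_bigE hm).1 he with ⟨j, hj, h⟩ | ⟨j, hj, rfl⟩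
  · obtain ⟨a1, a2, a3, a4, a5, -, -⟩ := afam_values hj
    obtain ⟨r1, r2, r3, r4, r5, r6⟩ := rel hj
    have hVj := hV j (by omega)
    rcases h with rfl | rfl | rfl | rfl | rfl
    · rw [a1]; linarith
    · rw [a2]; linarith
    · rw [a3]; linarith
    · rw [a4]; linarith
    · rw [a5]; linarith
  · rw [afam_Vfam (Finset.mem_Icc.2 ⟨by omega, by omega⟩), hV j hj, neg_mul_neg, mul_one]

theorem exists_dominating_node {m : ℕ} (hm : 1 ≤ m) {v : ℕ × ℕ} (hv : v ∈ bigV (m + 1)) :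
    ∃ u ∈ bigV (m + 1), u ≠ v ∧ ∀ e ∈ bigE (m + 1), v ∈ e → u ∈ e := by
  have mem_of_mem {k c c' : ℕ} (h : c = 1 ∧ c' = 2 ∨ (c = 2 ∨ c = 5 ∨ c = 6) ∧ c' = 1 ∨
      c = 3 ∧ c' = 4 ∨ (c = 4 ∨ c = 7 ∨ c = 8) ∧ c' = 3) :
      ∀ e ∈ bigE (m + 1), (k, c) ∈ e → (k, c') ∈ e := by
    intro e he
    rcases (mem_bigE hm).1 he with ⟨j, hj, rfl | rfl | rfl | rfl | rfl⟩ | ⟨j, hj, rfl⟩ <;>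
      simp only [mem_linkEdge, mem_tripleEdge, mem_Vfam (by omega : 2 ≤ m + 1)] <;> omega
  obtain ⟨j, hj, h⟩ := (mem_bigV hm).1 hv
  rcases h with rfl | rfl | rfl | rfl | rfl | rfl | rfl | rfl
  · exact ⟨(j + 2, 2), (mem_bigV hm).2 ⟨j, hj, by simp⟩, by simp, mem_of_mem (by simp)⟩
  · exact ⟨(j + 2, 1), (mem_bigV hm).2 ⟨j, hj, by simp⟩, by simp, mem_of_mem (by simp)⟩
  · exact ⟨(j + 2, 1), (mem_bigV hm).2 ⟨j, hj, by simp⟩, by simp, mem_of_mem (by simp)⟩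
  · exact ⟨(j + 2, 1), (mem_bigV hm).2 ⟨j, hj, by simp⟩, by simp, mem_of_mem (by simp)⟩
  · exact ⟨(j + 1, 4), (mem_bigV hm).2 ⟨j, hj, by simp⟩, by simp, mem_of_mem (by simp)⟩
  · exact ⟨(j + 1, 3), (mem_bigV hm).2 ⟨j, hj, by simp⟩, by simp, mem_of_mem (by simp)⟩
  · exact ⟨(j + 1, 3), (mem_bigV hm).2 ⟨j, hj, by simp⟩, by simp, mem_of_mem (by simp)⟩
  · exact ⟨(j + 1, 3), (mem_bigV hm).2 ⟨j, hj, by simp⟩, by simp, mem_of_mem (by simp)⟩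

theorem subset_bigV {m : ℕ} (hm : 1 ≤ m) : ∀ e ∈ bigE (m + 1), e ⊆ bigV (m + 1) := by
  rintro e he ⟨k, c⟩ hv
  have : ∃ i ∈ Finset.Icc 1 (m + 1), (k, c) ∈ Vfam (m + 1) i := by
    refine ⟨k, ?_⟩
    rw [Finset.mem_Icc, mem_Vfam (by omega)]
    rcases (mem_bigE hm).1 he with ⟨j, hj, rfl | rfl | rfl | rfl | rfl⟩ | ⟨j, hj, rfl⟩ <;>
      simp only [mem_linkEdge, mem_tripleEdge, mem_Vfam (by omega : 2 ≤ m + 1)] at hv <;> omega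
  exact Finset.mem_biUnion.2 this

theorem isBetaAcyclic_bigE {m : ℕ} (hm : 1 ≤ m) : IsBetaAcyclic (bigE (m + 1)) := by
  have hn : 2 ≤ m + 1 := by omega
  have outer {k c : ℕ} (hc : ¬ c ≤ 4) (hkc : (k, c) ∈ bigV (m + 1)) :
      ∃ T ⊆ Vfam (m + 1) k, ∀ e ∈ bigE (m + 1), (k, c) ∈ e → e = Vfam (m + 1) k ∨ e = T := by
    refine ⟨tripleEdge k (if c ≤ 6 then 1 else 3) (if c ≤ 6 then 2 else 4) c, ?_, ?_⟩
    · obtain ⟨j, hj, h⟩ := (mem_bigV hm).1 hkc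
      rintro ⟨k', c'⟩ h'
      simp only [Prod.mk.injEq] at h
      rw [mem_tripleEdge] at h'
      rw [mem_Vfam hn]
      split_ifs at h' <;> omega
    · intro e he hve
      rcases (mem_bigE hm).1 he with ⟨j, hj, rfl | rfl | rfl | rfl | rfl⟩ | ⟨j, hj, rfl⟩
      · rw [mem_linkEdge] at hve
        omega
      · obtain ⟨rfl, h⟩ := mem_tripleEdge.1 hve
        obtain rfl : c = 5 := by omega
        exact Or.inr rfl
      · obtain ⟨rfl, h⟩ := mem_tripleEdge.1 hve
        obtain rfl : c = 6 := by omega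
        exact Or.inr rfl
      · obtain ⟨rfl, h⟩ := mem_tripleEdge.1 hve
        obtain rfl : c = 7 := by omega
        exact Or.inr rfl
      · obtain ⟨rfl, h⟩ := mem_tripleEdge.1 hve
        obtain rfl : c = 8 := by omega
        exact Or.inr rfl
      · obtain ⟨rfl, h⟩ := (mem_Vfam hn).1 hve
        exact Or.inl rfl
  refine isBetaAcyclic_of_convex (fun v => v.2 ≤ 4) (fun v => 2 * v.1 + (v.2 - 1) / 2) ?_ ?_
  · rintro ⟨k, c⟩ hc e he hve f hf hvf
    obtain ⟨T, hT, h⟩ := outer hc (subset_bigV hm e he hve)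
    rcases h e he hve with rfl | rfl <;> rcases h f hf hvf with rfl | rfl
    · exact Or.inl subset_rfl
    · exact Or.inr hT
    · exact Or.inl hT
    · exact Or.inl subset_rfl
  · rintro e he f hf ⟨ku, cu⟩ hu ⟨kv, cv⟩ hv ⟨kw, cw⟩ hw hPu hPv hPw huw hwv
    have hcw : 1 ≤ cw := by
      rcases (mem_bigE hm).1 hf with ⟨j, hj, rfl | rfl | rfl | rfl | rfl⟩ | ⟨j, hj, rfl⟩ <;>
        simp only [mem_linkEdge, mem_tripleEdge, mem_Vfam hn] at hw <;> omega
    clear hw hf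
    dsimp only at hPu hPv hPw huw hwv
    rcases (mem_bigE hm).1 he with ⟨j, hj, rfl | rfl | rfl | rfl | rfl⟩ | ⟨j, hj, rfl⟩ <;>
      simp only [mem_linkEdge, mem_tripleEdge, mem_Vfam hn] at hu hv ⊢ <;> omega

theorem sum_afam {p : ℕ} :
    ∑ e ∈ bigE (p + 2), afam (p + 2) (Sum.inr e) = 2 * ((p + 2 : ℕ) : ℝ) - 3 := by
  have h := sum_afam_mul (m := p + 1) (by omega) fun _ => 1
  simp only [mul_one, Finset.sum_const, Finset.card_range, nsmul_eq_mul] at h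
  rw [h]
  push_cast
  ring

theorem block_bound {a b c₅ c₆ c₇ c₈ : ℝ} (ha : a = 0 ∨ a = 1) (hb : b = 0 ∨ b = 1)
    (h₅ : c₅ = 0 ∨ c₅ = 1) (h₆ : c₆ = 0 ∨ c₆ = 1) (h₇ : c₇ = 0 ∨ c₇ = 1) (h₈ : c₈ = 0 ∨ c₈ = 1) :
    a * c₅ + a * c₆ + (b * c₇ + b * c₈) - a * b * (c₅ * c₆ * (c₇ * c₈)) ≤ a + b + 1 := by
  rcases ha with rfl | rfl <;> rcases hb with rfl | rfl <;> rcases h₅ with rfl | rfl <;>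
    rcases h₆ with rfl | rfl <;> rcases h₇ with rfl | rfl <;> rcases h₈ with rfl | rfl <;> norm_num

theorem end_block_bound {a c c' : ℝ} (ha : a = 0 ∨ a = 1) (hc : c = 0 ∨ c = 1)
    (hc' : c' = 0 ∨ c' = 1) : a * c + a * c' - a * (c * c') ≤ a := by
  rcases ha with rfl | rfl <;> rcases hc with rfl | rfl <;> rcases hc' with rfl | rfl <;> norm_num

theorem link_bound {a b : ℝ} (ha : a = 0 ∨ a = 1) (hb : b = 0 ∨ b = 1) :
    -(b * a) ≤ 1 - b - a := by
  rcases ha with rfl | rfl <;> rcases hb with rfl | rfl <;> norm_num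

theorem dotp_afam_le {p : ℕ} {z : ((ℕ × ℕ) ⊕ Finset (ℕ × ℕ)) → ℝ}
    (hz : z ∈ mSet (bigV (p + 2)) (bigE (p + 2))) :
    dotp (bigV (p + 2)) (bigE (p + 2)) (afam (p + 2)) z ≤ 2 * ((p + 2 : ℕ) : ℝ) - 3 := by
  have hm : 1 ≤ p + 1 := by omega
  set x : ℕ → ℕ → ℝ := fun i c => z (Sum.inl (i, c))
  have hx (i c) : x i c = 0 ∨ x i c = 1 := by
    by_cases h : (i, c) ∈ bigV (p + 2)
    · exact hz.1 _ h
    · exact Or.inl (hz.2.1 _ h)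
  have mul01 {s t : ℝ} (hs : s = 0 ∨ s = 1) (ht : t = 0 ∨ t = 1) : s * t = 0 ∨ s * t = 1 := by
    rcases hs with rfl | rfl <;> rcases ht with rfl | rfl <;> simp
  set A : ℕ → ℝ := fun i => x i 1 * x i 2
  set B : ℕ → ℝ := fun i => x i 3 * x i 4
  have hA (i) : A i = 0 ∨ A i = 1 := mul01 (hx i 1) (hx i 2)
  have hB (i) : B i = 0 ∨ B i = 1 := mul01 (hx i 3) (hx i 4)
  have z_edge {e} (he : e ∈ bigE (p + 2)) : z (Sum.inr e) = ∏ v ∈ e, z (Sum.inl v) :=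
    hz.2.2.2 e he
  have z_link {j} (hj : j < p + 1) :
      z (Sum.inr (linkEdge (j + 1))) = B (j + 1) * A (j + 2) := by
    rw [z_edge ((mem_bigE hm).2 (Or.inl ⟨j, hj, by simp⟩))]
    simp [linkEdge, A, B, x, mul_assoc]
  have z_left₅ {j} (hj : j < p + 1) :
      z (Sum.inr (tripleEdge (j + 2) 1 2 5)) = A (j + 2) * x (j + 2) 5 := by
    rw [z_edge ((mem_bigE hm).2 (Or.inl ⟨j, hj, by simp⟩))]
    simp [tripleEdge, A, x, mul_assoc]
  have z_left₆ {j} (hj : j < p + 1) :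
      z (Sum.inr (tripleEdge (j + 2) 1 2 6)) = A (j + 2) * x (j + 2) 6 := by
    rw [z_edge ((mem_bigE hm).2 (Or.inl ⟨j, hj, by simp⟩))]
    simp [tripleEdge, A, x, mul_assoc]
  have z_right₇ {j} (hj : j < p + 1) :
      z (Sum.inr (tripleEdge (j + 1) 3 4 7)) = B (j + 1) * x (j + 1) 7 := by
    rw [z_edge ((mem_bigE hm).2 (Or.inl ⟨j, hj, by simp⟩))]
    simp [tripleEdge, B, x, mul_assoc]
  have z_right₈ {j} (hj : j < p + 1) :
      z (Sum.inr (tripleEdge (j + 1) 3 4 8)) = B (j + 1) * x (j + 1) 8 := by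
    rw [z_edge ((mem_bigE hm).2 (Or.inl ⟨j, hj, by simp⟩))]
    simp [tripleEdge, B, x, mul_assoc]
  have z_block_first : z (Sum.inr (Vfam (p + 2) 1)) = B 1 * (x 1 7 * x 1 8) := by
    rw [z_edge ((mem_bigE hm).2 (Or.inr ⟨0, by omega, rfl⟩))]
    simp [Vfam, B, x, mul_assoc]
  have z_block_last : z (Sum.inr (Vfam (p + 2) (p + 2))) =
      A (p + 2) * (x (p + 2) 5 * x (p + 2) 6) := by
    rw [z_edge ((mem_bigE hm).2 (Or.inr ⟨p + 1, by omega, rfl⟩))]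
    simp [Vfam, A, x, mul_assoc]
  have z_block {j} (hj : j < p) : z (Sum.inr (Vfam (p + 2) (j + 2))) =
      A (j + 2) * B (j + 2) * (x (j + 2) 5 * x (j + 2) 6 * (x (j + 2) 7 * x (j + 2) 8)) := by
    rw [z_edge ((mem_bigE hm).2 (Or.inr ⟨j + 1, by omega, rfl⟩))]
    simp [Vfam, A, B, x, mul_assoc, hj.ne]
  have hdotp : dotp (bigV (p + 2)) (bigE (p + 2)) (afam (p + 2)) z =
      ∑ j ∈ Finset.range (p + 1), -(B (j + 1) * A (j + 2)) +
      ∑ j ∈ Finset.range (p + 1), (A (j + 2) * x (j + 2) 5 + A (j + 2) * x (j + 2) 6) +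
      ∑ j ∈ Finset.range (p + 1), (B (j + 1) * x (j + 1) 7 + B (j + 1) * x (j + 1) 8) -
      ∑ j ∈ Finset.range (p + 2), z (Sum.inr (Vfam (p + 2) (j + 1))) := by
    have hnode : ∑ u ∈ bigV (p + 2), afam (p + 2) (Sum.inl u) * z (Sum.inl u) = 0 :=
      Finset.sum_eq_zero fun u _ => zero_mul _
    rw [dotp, hnode, zero_add, sum_afam_mul hm fun e => z (Sum.inr e), ← Finset.sum_add_distrib,
      ← Finset.sum_add_distrib]
    congr 1
    refine Finset.sum_congr rfl fun j hj => ?_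
    rw [Finset.mem_range] at hj
    rw [z_link hj, z_left₅ hj, z_left₆ hj, z_right₇ hj, z_right₈ hj]
    ring
  have hlink : ∑ j ∈ Finset.range (p + 1), -(B (j + 1) * A (j + 2)) ≤
      ∑ j ∈ Finset.range (p + 1), (1 - B (j + 1) - A (j + 2)) :=
    Finset.sum_le_sum fun j _ => link_bound (hA _) (hB _)
  have hblock : ∑ j ∈ Finset.range p, (A (j + 2) * x (j + 2) 5 + A (j + 2) * x (j + 2) 6 +
      (B (j + 2) * x (j + 2) 7 + B (j + 2) * x (j + 2) 8) -
      z (Sum.inr (Vfam (p + 2) (j + 2)))) ≤ ∑ j ∈ Finset.range p, (A (j + 2) + B (j + 2) + 1) :=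
    Finset.sum_le_sum fun j hj => by
      rw [z_block (Finset.mem_range.1 hj)]
      exact block_bound (hA _) (hB _) (hx _ _) (hx _ _) (hx _ _) (hx _ _)
  have hfirst := end_block_bound (hB 1) (hx 1 7) (hx 1 8)
  have hlast := end_block_bound (hA (p + 2)) (hx (p + 2) 5) (hx (p + 2) 6)
  rw [← z_block_first] at hfirst
  rw [← z_block_last] at hlast
  rw [Finset.sum_sub_distrib, Finset.sum_sub_distrib, Finset.sum_range_succ' (fun j => B (j + 1)),
    Finset.sum_range_succ (fun j => A (j + 2))] at hlink
  rw [hdotp, Finset.sum_range_succ (fun j => A (j + 2) * x (j + 2) 5 + A (j + 2) * x (j + 2) 6),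
    Finset.sum_range_succ' (fun j => B (j + 1) * x (j + 1) 7 + B (j + 1) * x (j + 1) 8),
    Finset.sum_range_succ (fun j => z (Sum.inr (Vfam (p + 2) (j + 1)))) (p + 1),
    Finset.sum_range_succ' (fun j => z (Sum.inr (Vfam (p + 2) (j + 1)))) p]
  simp only [Finset.sum_add_distrib, Finset.sum_sub_distrib, Finset.sum_const, Finset.card_range,
    nsmul_eq_mul, mul_one, zero_add, add_assoc, Nat.reduceAdd, Nat.cast_add, Nat.cast_one,
    Nat.cast_ofNat] at hlink hblock ⊢
  linarith

theorem isFacetIneq_afam {p : ℕ} :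
    IsFacetIneq (bigV (p + 2)) (bigE (p + 2)) (afam (p + 2)) (2 * ((p + 2 : ℕ) : ℝ) - 3) := by
  have hm : 1 ≤ p + 1 := by omega
  refine isFacetIneq_of_star_sums (subset_bigV hm)
    (isValidIneq_of_forall_mem_mSet fun z hz => dotp_afam_le hz)
    ⟨linkEdge 1, (mem_bigE hm).2 (Or.inl ⟨0, hm, Or.inl rfl⟩), ?_⟩ (fun _ => rfl) sum_afam
    (fun u hu => star_sum_afam hm hu) (fun v hv => exists_dominating_node hm hv)
    fun d hd => eq_mul_afam_of_star_sums hm hd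
  rw [show afam (p + 2) (Sum.inr (linkEdge 1)) = -1 from afam_linkEdge (m := p + 1) (j := 0) hm]
  norm_num

end Family


/-- a family of β-acyclic hypergraphs whose multilinear polytope has a
facet-defining inequality with exactly `|E|` nonzero coefficients. -/
theorem beta_acyclic_dense_facet (n : ℕ) (hn : 2 ≤ n) :
    IsBetaAcyclic (bigE n) ∧
    (∀ f ∈ bigE n, afam n (Sum.inr f) ≠ 0) ∧
    (∀ f ∉ bigE n, afam n (Sum.inr f) = 0) ∧
    (∀ u : ℕ × ℕ, afam n (Sum.inl u) = 0) ∧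
    IsFacetIneq (bigV n) (bigE n) (afam n) (2 * (n : ℝ) - 3) := by
  obtain ⟨p, rfl⟩ : ∃ p, n = p + 2 := ⟨n - 2, by omega⟩
  have hm : 1 ≤ p + 1 := by omega
  refine ⟨isBetaAcyclic_bigE hm, fun f hf => ?_, fun f hf => ?_, fun _ => rfl, isFacetIneq_afam⟩
  · simp only [afam, if_pos hf]
    split_ifs <;> norm_num
  · have hV : f ∉ (Finset.Icc 1 (p + 2)).image (Vfam (p + 2)) := by
      intro h
      obtain ⟨i, hi, rfl⟩ := Finset.mem_image.1 h
      rw [Finset.mem_Icc] at hi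
      exact hf ((mem_bigE hm).2 (Or.inr ⟨i - 1, by omega, by rw [Nat.sub_add_cancel hi.1]⟩))
    have hH : f ∉ Hfam (p + 2) := fun h => hf (Finset.mem_union_left _ h)
    simp only [afam, if_neg hV, if_neg hH, if_neg hf]
end

section
/- Let p be a nonempty finite set, and consider real numbers z_v, z_p, z_e, and z_u for each u ∈ p. Then there exist real numbers z^1_u (u ∈ p) satisfying the system: z^1_u ≤ z_v for all u ∈ p; z_p − z_e ≤ z_u − z^1_u for all u ∈ p; Σ_{u ∈ p} z^1_u − z_e ≤ (|p| − 1) z_v; z_u − z^1_u ≤ 1 − z_v for all u ∈ p; z_e ≤ z^1_u for all u ∈ p; and Σ_{u ∈ p} (z_u − z^1_u) − z_p + z_e ≤ (|p| − 1)(1 − z_v); if and only if the following hold: z_u ≤ 1 for all u ∈ p; z_e ≤ z_v; z_v + z_p − z_e ≤ 1; z_p ≤ z_u for all u ∈ p; and Σ_{u ∈ p} z_u − z_p ≤ |p| − 1. -/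
open BigOperators

variable {α : Type*} [DecidableEq α]

/-- Every value between `∑ l` and `∑ r` is the sum of a selection from the intervals
`[l u, r u]`. -/
lemma exists_between_sum_eq {ι : Type*} (s : Finset ι) (l r : ι → ℝ) (c : ℝ)
    (hlr : ∀ u ∈ s, l u ≤ r u) (hl : ∑ u ∈ s, l u ≤ c) (hr : c ≤ ∑ u ∈ s, r u) :
    ∃ x : ι → ℝ, (∀ u ∈ s, l u ≤ x u ∧ x u ≤ r u) ∧ ∑ u ∈ s, x u = c := by
  have hcont : ContinuousOn (fun t : ℝ => ∑ u ∈ s, (l u + t * (r u - l u))) (Set.Icc 0 1) := by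
    fun_prop
  obtain ⟨t, ⟨ht0, ht1⟩, ht⟩ :=
    intermediate_value_Icc zero_le_one hcont (show c ∈ _ by simpa using ⟨hl, hr⟩)
  refine ⟨fun u => l u + t * (r u - l u), fun u hu => ⟨?_, ?_⟩, ht⟩
  · nlinarith [hlr u hu]
  · nlinarith [hlr u hu]

/-- If every `f u` is at most `g u`, and moreover `f u₀ ≤ a` for some `u₀`, then `∑ f` is at most
`a` plus the sum of the remaining `g u`. -/
lemma sum_le_add_sum_erase {ι : Type*} [DecidableEq ι] {s : Finset ι} {f g : ι → ℝ} {a : ℝ}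
    {u₀ : ι} (hu₀ : u₀ ∈ s) (hfg : ∀ u ∈ s, f u ≤ g u) (ha : f u₀ ≤ a) :
    ∑ u ∈ s, f u ≤ a + (∑ u ∈ s, g u - g u₀) := by
  rw [← Finset.add_sum_erase s f hu₀, ← Finset.add_sum_erase s g hu₀, add_sub_cancel_left]
  exact add_le_add ha (Finset.sum_le_sum fun u hu => hfg u (Finset.mem_of_mem_erase hu))

/-- Fourier–Motzkin elimination of the auxiliary variables `z¹_u`, `u ∈ p`. -/
theorem fourier_motzkin_pointed
    (p : Finset α) (hp : p.Nonempty)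
    (zv zp ze : ℝ) (zu : α → ℝ) :
    (∃ z1 : α → ℝ,
        (∀ u ∈ p, z1 u ≤ zv) ∧
        (∀ u ∈ p, zp - ze ≤ zu u - z1 u) ∧
        ((∑ u ∈ p, z1 u) - ze ≤ ((p.card : ℝ) - 1) * zv) ∧
        (∀ u ∈ p, zu u - z1 u ≤ 1 - zv) ∧
        (∀ u ∈ p, ze ≤ z1 u) ∧
        ((∑ u ∈ p, (zu u - z1 u)) - zp + ze ≤ ((p.card : ℝ) - 1) * (1 - zv)))
      ↔ ((∀ u ∈ p, zu u ≤ 1) ∧ ze ≤ zv ∧ zv + zp - ze ≤ 1 ∧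
          (∀ u ∈ p, zp ≤ zu u) ∧ (∑ u ∈ p, zu u) - zp ≤ (p.card : ℝ) - 1) := by
  constructor
  · rintro ⟨z1, h1, h2, h3, h4, h5, h6⟩
    rw [Finset.sum_sub_distrib] at h6
    obtain ⟨u₀, hu₀⟩ := hp
    refine ⟨fun u hu => ?_, ?_, ?_, fun u hu => ?_, ?_⟩
    · linarith [h1 u hu, h4 u hu]
    · linarith [h1 u₀ hu₀, h5 u₀ hu₀]
    · linarith [h2 u₀ hu₀, h4 u₀ hu₀]
    · linarith [h2 u hu, h5 u hu]
    · linarith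
  · rintro ⟨h1, h2, h3, h4, h5⟩
    have hlr : ∀ u ∈ p, max (zu u - 1 + zv) ze ≤ min zv (zu u - zp + ze) := fun u hu => by
      have := h1 u hu
      have := h4 u hu
      refine max_le (le_min ?_ ?_) (le_min ?_ ?_) <;> linarith
    have hlU : ∑ u ∈ p, max (zu u - 1 + zv) ze ≤ ze + ((p.card : ℝ) - 1) * zv := by
      by_cases h : ∃ u ∈ p, zu u - 1 + zv ≤ ze
      · obtain ⟨u, hu, hle⟩ := h
        have := sum_le_add_sum_erase (g := fun _ => zv) hu
          (fun w hw => (hlr w hw).trans (min_le_left _ _)) (max_eq_right hle).le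
        simp only [Finset.sum_const, nsmul_eq_mul] at this
        linarith
      · push Not at h
        rw [Finset.sum_congr rfl fun u hu => max_eq_left (h u hu).le]
        simp only [Finset.sum_add_distrib, Finset.sum_sub_distrib, Finset.sum_const, nsmul_eq_mul]
        linarith
    have hLr : ∑ u ∈ p, zu u - zp + ze - ((p.card : ℝ) - 1) * (1 - zv) ≤
        ∑ u ∈ p, min zv (zu u - zp + ze) := by
      by_cases h : ∃ u ∈ p, zu u - zp + ze ≤ zv
      · obtain ⟨u, hu, hle⟩ := h
        have := sum_le_add_sum_erase (f := fun w => -min zv (zu w - zp + ze))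
          (g := fun w => -(zu w - 1 + zv)) hu
          (fun w hw => neg_le_neg ((le_max_left _ _).trans (hlr w hw)))
          (neg_le_neg (min_eq_right hle).ge)
        simp only [Finset.sum_neg_distrib, Finset.sum_add_distrib, Finset.sum_sub_distrib,
          Finset.sum_const, nsmul_eq_mul] at this
        linarith
      · push Not at h
        rw [Finset.sum_congr rfl fun u hu => min_eq_left (h u hu).le]
        simp only [Finset.sum_const, nsmul_eq_mul]
        linarith
    obtain ⟨z1, hz, hsum⟩ := exists_between_sum_eq p _ _
      (max (∑ u ∈ p, max (zu u - 1 + zv) ze)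
        (∑ u ∈ p, zu u - zp + ze - ((p.card : ℝ) - 1) * (1 - zv)))
      hlr (le_max_left _ _) (max_le (Finset.sum_le_sum hlr) hLr)
    have hU : ∑ u ∈ p, z1 u ≤ ze + ((p.card : ℝ) - 1) * zv :=
      hsum.trans_le (max_le hlU (by linarith))
    have hL := (le_max_right _ _).trans_eq hsum.symm
    simp only [max_le_iff, le_min_iff] at hz
    refine ⟨z1, fun u hu => (hz u hu).2.1, fun u hu => ?_, by linarith, fun u hu => ?_,
      fun u hu => (hz u hu).1.2, ?_⟩
    · linarith [(hz u hu).2.2]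
    · linarith [(hz u hu).1.1]
    · rw [Finset.sum_sub_distrib]
      linarith
end
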